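/- Let H' be any graph on four vertices and let G be a connected H'-minimal graph. Then G belongs to at least one of the following categories: (1) G is a subdivision of H'; (2) G has exactly four vertices; (3) G is a cycle (connected and 2-regular); (4) G is a wheel, i.e., G consists of an induced cycle plus one additional vertex adjacent to at least 3 vertices of that cycle; (5) G consists of an induced cycle plus one additional vertex; (6) G consists of two vertex-disjoint triangles x_1x_2x_3 and y_1y_2y_3 together with three pairwise vertex-disjoint paths P_1, P_2, P_3, where P_i joins x_i to y_i, each path is internally disjoint from both triangles, and every vertex of G lies on a triangle or a path; (7) G has at most five vertices of degree at least 3; (8) G is isomorphic to the complete bipartite graph K_{3,3}. -/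

import Mathlib

open SimpleGraph

variable {α β : Type*}

/-- A model of `H` in `G`: a family of pairwise disjoint nonempty vertex subsets of `G`,
each inducing a connected subgraph, such that for every edge `h h'` of `H` there is an
edge of `G` between `V h` and `V h'`. -/
def IsMinorModel (G : SimpleGraph α) (H : SimpleGraph β) (V : β → Set α) : Prop :=
  (∀ h, (V h).Nonempty) ∧
  (Pairwise fun h h' => Disjoint (V h) (V h')) ∧
  (∀ h, (G.induce (V h)).Connected) ∧
  ∀ h h', H.Adj h h' → ∃ x ∈ V h, ∃ y ∈ V h', G.Adj x y

/-- `H` is a minor of `G`. -/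
def HasMinor (G : SimpleGraph α) (H : SimpleGraph β) : Prop :=
  ∃ V : β → Set α, IsMinorModel G H V

/-- `G` is `H`-minimal: `H` is a minor of `G`, but for every vertex `x` of `G`,
`H` is not a minor of `G − x`. -/
def MinorMinimal (G : SimpleGraph α) (H : SimpleGraph β) : Prop :=
  HasMinor G H ∧ ∀ x : α, ¬ HasMinor (G.induce {y | y ≠ x}) H

/-- A graph is 2-connected if it has at least 3 vertices, is connected, and stays
connected after deleting any single vertex. -/
def TwoConnected [Fintype α] (G : SimpleGraph α) : Prop :=
  3 ≤ Fintype.card α ∧ G.Connected ∧ ∀ v : α, (G.induce {w | w ≠ v}).Connected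

/-- `G` is a cycle: connected and 2-regular. -/
def IsCycleGraph (G : SimpleGraph α) : Prop :=
  G.Connected ∧ ∀ v : α, (G.neighborSet v).ncard = 2
/-- `G` is a subdivision of `H`: `G` is obtained from `H` by replacing each edge by a
path between (the images of) its endpoints, these paths being internally disjoint from
each other and from the (images of the) vertices of `H`. -/
def IsSubdivision (G : SimpleGraph α) (H : SimpleGraph β) : Prop :=
  ∃ v : β → α, Function.Injective v ∧
    ∃ P : ∀ ⦃a b : β⦄, H.Adj a b → G.Walk (v a) (v b),
      (∀ a b (h : H.Adj a b), (P h).IsPath) ∧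
      (∀ a b (h : H.Adj a b), P h.symm = (P h).reverse) ∧
      (∀ a b (h : H.Adj a b) a' b' (h' : H.Adj a' b'), s(a, b) ≠ s(a', b') →
        ∀ x, x ∈ (P h).support → x ∈ (P h').support → x = v a ∨ x = v b) ∧
      (∀ a b (h : H.Adj a b) (c : β), v c ∈ (P h).support → c = a ∨ c = b) ∧
      (∀ x : α, (∃ c, x = v c) ∨ ∃ (a b : β) (h : H.Adj a b), x ∈ (P h).support) ∧
      (∀ x y : α, G.Adj x y ↔ ∃ (a b : β) (h : H.Adj a b), s(x, y) ∈ (P h).edges)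

/-- `G` is a wheel: an induced cycle plus one additional vertex adjacent to at least
3 vertices of the cycle. -/
def IsWheel (G : SimpleGraph α) : Prop :=
  ∃ w : α, ((G.induce {u | u ≠ w}).Connected ∧
      ∀ u : {u : α // u ≠ w}, ((G.induce {u | u ≠ w}).neighborSet u).ncard = 2) ∧
    3 ≤ (G.neighborSet w).ncard
/-- `G` consists of two vertex-disjoint triangles `x 0, x 1, x 2` and `y 0, y 1, y 2`
together with three pairwise vertex-disjoint paths, the `i`-th joining `x i` to `y i`,
each internally disjoint from both triangles, every vertex of `G` lying on one of the
triangles or paths, and every edge of `G` being a triangle edge or a path edge. -/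
def TwoTrianglesThreePaths (G : SimpleGraph α) : Prop :=
  ∃ x y : Fin 3 → α,
    (∀ i j, i ≠ j → G.Adj (x i) (x j)) ∧
    (∀ i j, i ≠ j → G.Adj (y i) (y j)) ∧
    (∀ i j, x i ≠ y j) ∧
    ∃ P : (i : Fin 3) → G.Walk (x i) (y i),
      (∀ i, (P i).IsPath) ∧
      (∀ i j, i ≠ j → ∀ z, z ∈ (P i).support → z ∉ (P j).support) ∧
      (∀ i j z, z ∈ (P i).support → (z = x j ∨ z = y j) → (z = x i ∨ z = y i)) ∧
      (∀ z : α, ∃ i, z ∈ (P i).support) ∧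
      (∀ z w, G.Adj z w →
        (∃ i j, i ≠ j ∧ ((z = x i ∧ w = x j) ∨ (z = y i ∧ w = y j))) ∨
        ∃ i, s(z, w) ∈ (P i).edges)

section

namespace FourVertexMinor

variable {G : SimpleGraph α}

/-- Connectivity of a vertex set, expressed through closed subsets. -/
def Conn (G : SimpleGraph α) (S : Set α) : Prop :=
  S.Nonempty ∧ ∀ A : Set α, (∃ a ∈ S, a ∈ A) →
    (∀ a ∈ S, a ∈ A → ∀ b ∈ S, G.Adj a b → b ∈ A) → S ⊆ A

theorem Conn.connected {S : Set α} (h : Conn G S) : (G.induce S).Connected := by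
  obtain ⟨⟨s, hs⟩, h⟩ := h
  rw [connected_iff_exists_forall_reachable]
  refine ⟨⟨s, hs⟩, fun w => ?_⟩
  have := h {x | ∃ hx : x ∈ S, (G.induce S).Reachable ⟨s, hs⟩ ⟨x, hx⟩} ⟨s, hs, hs, .refl _⟩
    (fun a ha ⟨_, hr⟩ b hb hab => ⟨hb, hr.trans (Adj.reachable (by simpa using hab))⟩) w.2
  exact this.2

theorem conn_of_connected {S : Set α} (h : (G.induce S).Connected) : Conn G S := by
  refine ⟨?_, fun A ⟨a, ha, haA⟩ hcl w hw => ?_⟩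
  · obtain ⟨x⟩ := h.nonempty
    exact ⟨x, x.2⟩
  · obtain ⟨p⟩ := h.preconnected ⟨a, ha⟩ ⟨w, hw⟩
    have key : ∀ (u v : S), (G.induce S).Walk u v → u.1 ∈ A → v.1 ∈ A := by
      intro u v p
      induction p with
      | nil => exact id
      | cons hadj _ ih => exact fun hu => ih (hcl _ (Subtype.prop _) hu _ (Subtype.prop _) hadj)
    exact key _ _ p haA

theorem Conn.exists_crossing {S : Set α} (h : Conn G S) (A : Set α) (h1 : ∃ a ∈ S, a ∈ A)
    (h2 : ∃ b ∈ S, b ∉ A) : ∃ a ∈ S, a ∈ A ∧ ∃ b ∈ S, b ∉ A ∧ G.Adj a b := by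
  by_contra! hc
  obtain ⟨b, hb, hbA⟩ := h2
  exact hbA (h.2 A h1 (fun a ha haA b hb hab => by
    by_contra hbA
    exact hc a ha haA b hb hbA hab) hb)

theorem conn_singleton (x : α) : Conn G {x} := by
  refine ⟨⟨x, rfl⟩, ?_⟩
  rintro A ⟨a, rfl, ha⟩ - b rfl
  exact ha

theorem Conn.union_adj {S T : Set α} (hS : Conn G S) (hT : Conn G T) {a b : α} (ha : a ∈ S)
    (hb : b ∈ T) (hab : G.Adj a b) : Conn G (S ∪ T) := by
  refine ⟨⟨a, Or.inl ha⟩, fun A ⟨c, hc, hcA⟩ hcl => ?_⟩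
  have hSA : (∃ a ∈ S, a ∈ A) → S ⊆ A := fun h =>
    hS.2 A h fun a ha haA b hb hab => hcl a (Or.inl ha) haA b (Or.inl hb) hab
  have hTA : (∃ a ∈ T, a ∈ A) → T ⊆ A := fun h =>
    hT.2 A h fun a ha haA b hb hab => hcl a (Or.inr ha) haA b (Or.inr hb) hab
  rcases hc with hc | hc
  · have h1 := hSA ⟨c, hc, hcA⟩
    exact Set.union_subset h1
      (hTA ⟨b, hb, hcl a (Or.inl ha) (h1 ha) b (Or.inr hb) hab⟩)
  · have h1 := hTA ⟨c, hc, hcA⟩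
    exact Set.union_subset
      (hSA ⟨a, ha, hcl b (Or.inr hb) (h1 hb) a (Or.inl ha) hab.symm⟩) h1

theorem conn_list {l : List α} (h0 : l ≠ []) (h : l.IsChain G.Adj) : Conn G {x | x ∈ l} := by
  induction l with
  | nil => exact absurd rfl h0
  | cons a l ih =>
    cases l with
    | nil => simpa using conn_singleton (G := G) a
    | cons b l =>
      rw [List.isChain_cons_cons] at h
      have h1 := (conn_singleton (G := G) a).union_adj (ih (by simp) h.2) rfl
        (b := b) (by simp) h.1
      convert h1 using 1
      ext x
      simp

theorem chain_reverse {l : List α} (h : l.IsChain G.Adj) : l.reverse.IsChain G.Adj := by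
  rw [List.isChain_reverse]
  exact h.imp fun _ _ h => h.symm

/-- A chain has no chords. -/
def Ind (G : SimpleGraph α) (l : List α) : Prop :=
  ∀ A u B v E, l = A ++ u :: (B ++ v :: E) → G.Adj u v → B = []

/-- A shortest path inside a connected set from a vertex to a target set. -/
theorem Conn.exists_path {S : Set α} (h : Conn G S) {x : α} (hx : x ∈ S) {Y : Set α}
    (hY : ∃ y ∈ S, y ∈ Y) :
    ∃ (l : List α) (y : α), y ∈ Y ∧ (l ++ [y]).head? = some x ∧ (∀ z ∈ l ++ [y], z ∈ S) ∧
      (l ++ [y]).IsChain G.Adj ∧ (l ++ [y]).Nodup ∧ Ind G (l ++ [y]) ∧ (∀ z ∈ l, z ∉ Y) ∧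
      (∀ A u B z, l = A ++ u :: B → z ∈ S → z ∈ Y → G.Adj u z → B = []) := by
  classical
  let P : ℕ → Prop := fun n => ∃ (l : List α) (y : α), l.length = n ∧ y ∈ Y ∧
    (l ++ [y]).head? = some x ∧ (∀ z ∈ l ++ [y], z ∈ S) ∧ (l ++ [y]).IsChain G.Adj
  have hP : ∃ n, P n := by
    obtain ⟨y, hyS, hyY⟩ := hY
    have := h.2 {v | ∃ l : List α, (l ++ [v]).head? = some x ∧ (∀ z ∈ l ++ [v], z ∈ S) ∧
      (l ++ [v]).IsChain G.Adj} ⟨x, hx, [], by simp, by simpa using hx, by simp⟩ (by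
        rintro a ha ⟨l, h1, h2, h3⟩ b hb hab
        refine ⟨l ++ [a], ?_, ?_, ?_⟩
        · rw [List.head?_append, h1]; rfl
        · intro z hz
          rw [List.mem_append] at hz
          rcases hz with hz | hz
          · exact h2 z hz
          · simp at hz; exact hz ▸ hb
        · rw [List.append_assoc, List.singleton_append, List.isChain_append_cons_cons]
          exact ⟨h3, hab, by simp⟩) hyS
    obtain ⟨l, h1, h2, h3⟩ := this
    exact ⟨_, l, y, rfl, hyY, h1, h2, h3⟩
  obtain ⟨l, y, hlen, hyY, h1, h2, h3⟩ := Nat.find_spec hP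
  have hmin : ∀ (l' : List α) (y' : α), y' ∈ Y → (l' ++ [y']).head? = some x →
      (∀ z ∈ l' ++ [y'], z ∈ S) → (l' ++ [y']).IsChain G.Adj → l.length ≤ l'.length := by
    intro l' y' a b c d
    rw [hlen]
    exact Nat.find_min' hP ⟨l', y', rfl, a, b, c, d⟩
  -- removing the part strictly between two vertices joined by an edge or coinciding
  have hshort : ∀ A u B v E, l ++ [y] = A ++ u :: (B ++ v :: E) →
      G.Adj u v → B = [] := by
    intro A u B v E he hadj
    rcases List.eq_nil_or_concat' E with rfl | ⟨E', z, rfl⟩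
    · have h4 : l = A ++ u :: B ∧ y = v := by
        have : l ++ [y] = (A ++ u :: B) ++ [v] := by rw [he]; simp
        simpa using List.append_inj' this rfl
      obtain ⟨rfl, rfl⟩ := h4
      have := hmin (A ++ [u]) y hyY ?_ ?_ ?_
      · simp only [List.length_append, List.length_cons, List.length_nil] at this
        exact List.eq_nil_of_length_eq_zero (by omega)
      · cases A <;> simpa using h1
      · intro z hz; apply h2; simp at hz ⊢; tauto
      · have h3' : (A ++ u :: (B ++ [y])).IsChain G.Adj := by simpa using h3
        rw [List.isChain_split] at h3'
        simpa [List.isChain_append_cons_cons] using ⟨h3'.1, hadj⟩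
    · have h4 : l = A ++ u :: (B ++ v :: E') ∧ y = z := by
        have : l ++ [y] = (A ++ u :: (B ++ v :: E')) ++ [z] := by rw [he]; simp
        simpa using List.append_inj' this rfl
      obtain ⟨rfl, rfl⟩ := h4
      have := hmin (A ++ u :: v :: E') y hyY ?_ ?_ ?_
      · simp only [List.length_append, List.length_cons] at this
        exact List.eq_nil_of_length_eq_zero (by omega)
      · cases A <;> simpa using h1
      · intro z hz; apply h2; simp at hz ⊢; tauto
      · have h3' : (A ++ u :: (B ++ v :: (E' ++ [y]))).IsChain G.Adj := by simpa using h3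
        rw [List.isChain_split] at h3'
        have h5 := h3'.2
        rw [← List.cons_append, List.isChain_split] at h5
        have h6 : (A ++ u :: v :: (E' ++ [y])).IsChain G.Adj := by
          rw [List.isChain_append_cons_cons]
          exact ⟨h3'.1, hadj, h5.2⟩
        simpa using h6
  have hpre : ∀ A u B, l = A ++ u :: B → u ∉ Y := by
    rintro A u B rfl hu
    have := hmin A u hu ?_ ?_ ?_
    · simp at this
    · cases A <;> simpa using h1
    · intro z hz; apply h2; simp at hz ⊢; tauto
    · have h3' : (A ++ u :: (B ++ [y])).IsChain G.Adj := by simpa using h3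
      rw [List.isChain_split] at h3'
      exact h3'.1
  have hnd : (l ++ [y]).Nodup := by
    by_contra hnd
    rw [List.nodup_iff_forall_not_duplicate] at hnd
    push Not at hnd
    obtain ⟨u, hu⟩ := hnd
    rw [List.duplicate_iff_sublist] at hu
    have : ∃ A B E, l ++ [y] = A ++ u :: (B ++ u :: E) := by
      have hm := hu.subset (List.mem_cons_self)
      obtain ⟨A, F, hA⟩ := List.append_of_mem hm
      by_cases huA : u ∈ A
      · obtain ⟨A1, A2, rfl⟩ := List.append_of_mem huA
        exact ⟨A1, A2, F, by rw [hA]; simp⟩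
      · have huF : u ∈ F := by
          have hc := hu.count_le u
          rw [hA] at hc
          simp [List.count_eq_zero_of_not_mem huA] at hc
          exact hc
        obtain ⟨B, E, rfl⟩ := List.append_of_mem huF
        exact ⟨A, B, E, hA⟩
    obtain ⟨A, B, E, he⟩ := this
    rcases List.eq_nil_or_concat' E with rfl | ⟨E', z, rfl⟩
    · have h4 : l = A ++ u :: B ∧ y = u := by
        have : l ++ [y] = (A ++ u :: B) ++ [u] := by rw [he]; simp
        simpa using List.append_inj' this rfl
      exact hpre A u B h4.1 (h4.2 ▸ hyY)
    · have h4 : l = A ++ u :: (B ++ u :: E') ∧ y = z := by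
        have : l ++ [y] = (A ++ u :: (B ++ u :: E')) ++ [z] := by rw [he]; simp
        simpa using List.append_inj' this rfl
      obtain ⟨rfl, rfl⟩ := h4
      have := hmin (A ++ u :: E') y hyY ?_ ?_ ?_
      · simp only [List.length_append, List.length_cons] at this
        omega
      · cases A <;> simpa using h1
      · intro z hz; apply h2; simp at hz ⊢; tauto
      · have h3' : (A ++ u :: (B ++ u :: (E' ++ [y]))).IsChain G.Adj := by simpa using h3
        rw [List.isChain_split] at h3'
        have h5 := h3'.2
        rw [← List.cons_append, List.isChain_split] at h5
        have h6 : (A ++ u :: (E' ++ [y])).IsChain G.Adj := by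
          rw [List.isChain_split]
          exact ⟨h3'.1, h5.2⟩
        simpa using h6
  refine ⟨l, y, hyY, h1, h2, h3, hnd, hshort, fun z hz => ?_, ?_⟩
  · obtain ⟨A, B, rfl⟩ := List.append_of_mem hz
    exact hpre A z B rfl
  · rintro A u B z rfl hzS hzY hadj
    have := hmin (A ++ [u]) z hzY ?_ ?_ ?_
    · simp only [List.length_append, List.length_cons, List.length_nil] at this
      exact List.eq_nil_of_length_eq_zero (by omega)
    · cases A <;> simpa using h1
    · intro w hw
      simp at hw
      rcases hw with hw | rfl | rfl
      · apply h2; simp; tauto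
      · apply h2; simp
      · exact hzS
    · have h3' : (A ++ u :: (B ++ [y])).IsChain G.Adj := by simpa using h3
      rw [List.isChain_split] at h3'
      simpa [List.isChain_append_cons_cons] using ⟨h3'.1, hadj⟩

/-- A list that traverses a cycle of `G`. -/
def Cyc (G : SimpleGraph α) (l : List α) : Prop :=
  3 ≤ l.length ∧ l.Nodup ∧ (l ++ l.take 1).IsChain G.Adj

theorem cyc_split {a b : α} {A B : List α} : Cyc G (a :: A ++ b :: B) ↔
    3 ≤ (a :: A ++ b :: B).length ∧ (a :: A ++ b :: B).Nodup ∧ (a :: A ++ [b]).IsChain G.Adj ∧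
      (b :: B ++ [a]).IsChain G.Adj := by
  have : a :: A ++ b :: B ++ (a :: A ++ b :: B).take 1 = (a :: A) ++ b :: (B ++ [a]) := by simp
  rw [Cyc, this, List.isChain_split]
  simp

theorem Cyc.ne_nil {l : List α} (h : Cyc G l) : l ≠ [] := by
  rintro rfl
  simpa using h.1

theorem Cyc.chain {l : List α} (h : Cyc G l) : l.IsChain G.Adj :=
  (List.isChain_append.1 h.2.2).1

theorem Cyc.rotate {l₁ l₂ : List α} (h : Cyc G (l₁ ++ l₂)) : Cyc G (l₂ ++ l₁) := by
  cases l₁ with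
  | nil => simpa using h
  | cons a A =>
    cases l₂ with
    | nil => simpa using h
    | cons b B =>
      rw [cyc_split] at h ⊢
      refine ⟨?_, ?_, h.2.2.2, h.2.2.1⟩
      · have := h.1
        simp only [List.length_append, List.length_cons] at this ⊢
        omega
      · rw [List.nodup_append_comm]
        exact h.2.1

theorem Cyc.reverse_tail {a : α} {A : List α} (h : Cyc G (a :: A)) : Cyc G (a :: A.reverse) := by
  refine ⟨by simpa using h.1, by simpa using h.2.1, ?_⟩
  have := chain_reverse h.2.2
  simpa using this

theorem Cyc.exists_cons {l : List α} (h : Cyc G l) {a : α} (ha : a ∈ l) :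
    ∃ A, Cyc G (a :: A) ∧ (a :: A).Perm l := by
  obtain ⟨X, Y, rfl⟩ := List.append_of_mem ha
  exact ⟨Y ++ X, h.rotate, List.perm_append_comm (l₁ := a :: Y)⟩

theorem Cyc.exists_two {l : List α} (h : Cyc G l) {a b : α} (ha : a ∈ l) (hb : b ∈ l)
    (hab : a ≠ b) : ∃ A B, Cyc G (a :: A ++ b :: B) ∧ (a :: A ++ b :: B).Perm l := by
  obtain ⟨X, hX, hp⟩ := h.exists_cons ha
  have : b ∈ X := by
    have := hp.mem_iff.2 hb
    simpa [hab.symm] using this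
  obtain ⟨A, B, rfl⟩ := List.append_of_mem this
  exact ⟨A, B, hX, hp⟩

theorem Cyc.exists_three {l : List α} (h : Cyc G l) {a b c : α} (ha : a ∈ l) (hb : b ∈ l)
    (hc : c ∈ l) (hab : a ≠ b) (hac : a ≠ c) (hbc : b ≠ c) :
    ∃ A B C, Cyc G (a :: A ++ b :: (B ++ c :: C)) ∧ (a :: A ++ b :: (B ++ c :: C)).Perm l := by
  obtain ⟨X, Y, hX, hp⟩ := h.exists_two ha hb hab
  have hc' := hp.mem_iff.2 hc
  simp only [List.mem_cons, List.mem_append, List.cons_append, hac.symm, hbc.symm, false_or] at hc'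
  rcases hc' with hc' | hc'
  · obtain ⟨P, Q, rfl⟩ := List.append_of_mem hc'
    refine ⟨Y.reverse, Q.reverse, P.reverse, ?_, ?_⟩
    · have := hX.reverse_tail (a := a)
      simpa using this
    · refine List.Perm.trans ?_ hp
      have : a :: Y.reverse ++ b :: (Q.reverse ++ c :: P.reverse) =
        a :: ((P ++ c :: Q) ++ b :: Y).reverse := by simp
      rw [this]
      exact List.Perm.cons _ (List.reverse_perm _)
  · obtain ⟨P, Q, rfl⟩ := List.append_of_mem hc'
    exact ⟨X, P, Q, hX, hp⟩

/-- The cycle on one side of a chord. -/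
theorem Cyc.chord {u v : α} {A B : List α} (h : Cyc G (u :: A ++ v :: B)) (hA : A ≠ [])
    (huv : G.Adj u v) : Cyc G (u :: A ++ [v]) := by
  rw [cyc_split] at h ⊢
  refine ⟨?_, ?_, h.2.2.1, by simpa using huv.symm⟩
  · have := List.length_pos_iff.2 hA
    simp only [List.length_append, List.length_cons, List.length_nil]
    omega
  · refine h.2.1.sublist ?_
    simp

/-- Every vertex of the list `l` has exactly two neighbours in `l`. -/
def Chordless (G : SimpleGraph α) (l : List α) : Prop :=
  ∀ x ∈ l, ∃ y ∈ l, ∃ z ∈ l, y ≠ z ∧ G.Adj x y ∧ G.Adj x z ∧ ∀ w ∈ l, G.Adj x w → w = y ∨ w = z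

theorem Cyc.exists_nbrs {l : List α} (h : Cyc G l) {x : α} (hx : x ∈ l) :
    ∃ y z M, Cyc G (x :: y :: (M ++ [z])) ∧ (x :: y :: (M ++ [z])).Perm l ∧ y ≠ z ∧ G.Adj x y ∧
      G.Adj x z := by
  obtain ⟨A, hA, hp⟩ := h.exists_cons hx
  cases A with
  | nil => simpa using hA.1
  | cons y A =>
    rcases List.eq_nil_or_concat' A with rfl | ⟨M, z, rfl⟩
    · simpa using hA.1
    · refine ⟨y, z, M, hA, hp, ?_, ?_, ?_⟩
      · have := hA.2.1
        simp at this
        tauto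
      · have := hA.2.2
        simp at this
        exact this.1
      · have := hA.2.2
        have h2 : x :: y :: (M ++ [z]) ++ (x :: y :: (M ++ [z])).take 1 =
          (x :: y :: M) ++ z :: [x] := by simp
        rw [h2, List.isChain_split] at this
        exact G.adj_symm (by simpa using this.2)

theorem Cyc.chordless {l : List α} (h : Cyc G l)
    (hc : ∀ u A v B, Cyc G (u :: A ++ v :: B) → (u :: A ++ v :: B).Perm l → G.Adj u v →
      A = [] ∨ B = []) : Chordless G l := by
  intro x hx
  obtain ⟨y, z, M, hM, hp, hyz, hxy, hxz⟩ := h.exists_nbrs hx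
  refine ⟨y, hp.mem_iff.1 (by simp), z, hp.mem_iff.1 (by simp), hyz, hxy, hxz, fun w hw hxw => ?_⟩
  have hw' := hp.mem_iff.2 hw
  simp only [List.mem_cons, List.mem_append, List.not_mem_nil, or_false] at hw'
  rcases hw' with rfl | rfl | hw' | rfl
  · exact absurd hxw (G.irrefl)
  · exact Or.inl rfl
  · obtain ⟨P, Q, rfl⟩ := List.append_of_mem hw'
    have := hc x (y :: P) w (Q ++ [z]) (by simpa using hM) (by simpa using hp) hxw
    simp at this
  · exact Or.inr rfl

/-- The vertices of `l` with a neighbour in `D`. -/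
def att (G : SimpleGraph α) (l : List α) (D : Set α) : Set α := {t | t ∈ l ∧ ∃ d ∈ D, G.Adj d t}

theorem att_finite (l : List α) (D : Set α) : (att G l D).Finite :=
  (List.finite_toSet l).subset fun _ h => h.1

/-- A cycle together with a disjoint connected set attached to at least `k` of its vertices. -/
def Str (G : SimpleGraph α) (k : ℕ) (l : List α) (D : Set α) : Prop :=
  Cyc G l ∧ Conn G D ∧ (∀ x ∈ l, x ∉ D) ∧ k ≤ (att G l D).ncard

theorem le_ncard_att {l : List α} {D : Set α} {k : ℕ} (hk : k ≤ 3) {a b c : α}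
    (ha : a ∈ l) (hb : b ∈ l) (hc : c ∈ l) (hab : a ≠ b) (hac : a ≠ c) (hbc : b ≠ c)
    (ha' : ∃ d ∈ D, G.Adj d a) (hb' : ∃ d ∈ D, G.Adj d b) (hc' : ∃ d ∈ D, G.Adj d c) :
    k ≤ (att G l D).ncard := by
  have h1 : ({a, b, c} : Set α) ⊆ att G l D := by
    rintro x (rfl | rfl | rfl)
    · exact ⟨ha, ha'⟩
    · exact ⟨hb, hb'⟩
    · exact ⟨hc, hc'⟩
  have h2 := Set.ncard_le_ncard h1 (att_finite l D)
  rw [Set.ncard_eq_three.2 ⟨a, b, c, hab, hac, hbc, rfl⟩] at h2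
  omega

theorem Str.chord {k : ℕ} (hk : k ≤ 3) {u v : α} {A B : List α} {D : Set α}
    (h : Str G k (u :: A ++ v :: B) D) (hA : A ≠ []) (hB : B ≠ []) (huv : G.Adj u v) :
    ∃ l' D', Str G k l' D' ∧ l'.length < (u :: A ++ v :: B).length := by
  obtain ⟨hc, hD, hdis, hn⟩ := h
  have hA' := List.length_pos_iff.2 hA
  have hB' := List.length_pos_iff.2 hB
  have hc1 := hc.chord hA huv
  have hc2 := hc.rotate.chord hB huv.symm
  by_cases h1 : ∃ b ∈ B, ∃ d ∈ D, G.Adj d b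
  · by_cases h2 : ∃ a ∈ A, ∃ d ∈ D, G.Adj d a
    · obtain ⟨b, hb, d, hd, hdb⟩ := h1
      obtain ⟨a, ha, d', hd', hda⟩ := h2
      have hnd := hc.2.1
      rw [cyc_split] at hc
      obtain ⟨B1, y, rfl⟩ := List.eq_nil_or_concat' B |>.resolve_left hB
      obtain ⟨x, B2, hB2⟩ := List.exists_cons_of_ne_nil hB
      have hchB : (B1 ++ [y]).IsChain G.Adj := by
        have := hc.2.2.2
        rw [List.cons_append, List.isChain_cons, List.isChain_append] at this
        exact this.2.1
      have hvx : G.Adj v x := by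
        have := hc.2.2.2
        rw [hB2] at this
        simp at this
        exact this.1
      have hyu : G.Adj y u := by
        have := hc.2.2.2
        have h3 : v :: (B1 ++ [y]) ++ [u] = (v :: B1) ++ y :: [u] := by simp
        rw [h3, List.isChain_split] at this
        simpa using this.2
      refine ⟨u :: A ++ [v], D ∪ {x | x ∈ B1 ++ [y]}, ⟨hc1, ?_, ?_, ?_⟩, ?_⟩
      · exact hD.union_adj (conn_list (by simp) hchB) hd hb hdb
      · intro w hw
        have hwB : w ∉ B1 ++ [y] := by
          simp only [List.nodup_append, List.nodup_cons] at hnd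
          simp at hnd hw ⊢
          grind
        have hwD := hdis w (by simp at hw ⊢; tauto)
        simp only [Set.mem_union, not_or]
        exact ⟨hwD, hwB⟩
      · have hnd' : u ≠ v ∧ u ∉ A ∧ v ∉ A := by
          simp only [List.nodup_append, List.nodup_cons] at hnd
          simp at hnd
          grind
        refine le_ncard_att hk (a := u) (b := v) (c := a) (by simp) (by simp) (by simp [ha])
          hnd'.1 (fun e => hnd'.2.1 (e ▸ ha)) (fun e => hnd'.2.2 (e ▸ ha))
          ⟨y, Or.inr (by simp), hyu⟩ ⟨x, Or.inr ?_, hvx.symm⟩ ⟨d', Or.inl hd', hda⟩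
        simp [hB2]
      · simp only [List.length_append, List.length_cons, List.length_nil] at hB' ⊢
        omega
    · refine ⟨v :: B ++ [u], D, ⟨hc2, hD, ?_, ?_⟩, ?_⟩
      · intro x hx; apply hdis; simp at hx ⊢; tauto
      · refine hn.trans (Set.ncard_le_ncard ?_ (att_finite _ _))
        rintro t ⟨ht, htD⟩
        refine ⟨?_, htD⟩
        have : t ∉ A := fun h => h2 ⟨t, h, htD⟩
        simp at ht ⊢
        tauto
      · simp only [List.length_append, List.length_cons, List.length_nil]
        omega
  · refine ⟨u :: A ++ [v], D, ⟨hc1, hD, ?_, ?_⟩, ?_⟩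
    · intro x hx; apply hdis; simp at hx ⊢; tauto
    · refine hn.trans (Set.ncard_le_ncard ?_ (att_finite _ _))
      rintro t ⟨ht, htD⟩
      refine ⟨?_, htD⟩
      have : t ∉ B := fun h => h1 ⟨t, h, htD⟩
      simp at ht ⊢
      tauto
    · simp only [List.length_append, List.length_cons, List.length_nil]
      omega

theorem Str.of_perm {k : ℕ} {l l' : List α} {D : Set α} (h : Str G k l D) (hl : Cyc G l')
    (hp : l'.Perm l) : Str G k l' D := by
  refine ⟨hl, h.2.1, fun x hx => h.2.2.1 x (hp.mem_iff.1 hx), ?_⟩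
  have : att G l' D = att G l D := by
    ext x
    simp [att, hp.mem_iff]
  rw [this]
  exact h.2.2.2

theorem exists_min_str {k : ℕ} (hk : k ≤ 3) (h : ∃ l D, Str G k l D) :
    ∃ l D, Str G k l D ∧ Chordless G l ∧ ∀ l' D', Str G k l' D' → l.length ≤ l'.length := by
  classical
  have hP : ∃ n, ∃ l D, Str G k l D ∧ l.length = n := by
    obtain ⟨l, D, h⟩ := h
    exact ⟨_, l, D, h, rfl⟩
  obtain ⟨l, D, hs, hl⟩ := Nat.find_spec hP
  have hmin : ∀ l' D', Str G k l' D' → l.length ≤ l'.length := fun l' D' h' => by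
    rw [hl]
    exact Nat.find_min' hP ⟨l', D', h', rfl⟩
  refine ⟨l, D, hs, hs.1.chordless fun u A v B hc hp huv => ?_, hmin⟩
  by_contra! hne
  obtain ⟨l', D', h', hlt⟩ := (hs.of_perm hc hp).chord hk hne.1 hne.2 huv
  have := hmin l' D' h'
  rw [← hp.length_eq] at this
  omega

theorem Conn.exists_list {S : Set α} (h : Conn G S) {x y : α} (hx : x ∈ S) (hy : y ∈ S) :
    ∃ l : List α, l.head? = some x ∧ l.getLast? = some y ∧ (∀ z ∈ l, z ∈ S) ∧
      l.IsChain G.Adj ∧ l.Nodup ∧ Ind G l := by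
  obtain ⟨l, y', hy', h1, h2, h3, h4, h5, -⟩ := h.exists_path hx (Y := {y}) ⟨y, hy, rfl⟩
  obtain rfl : y' = y := hy'
  exact ⟨l ++ [y'], h1, by simp, h2, h3, h4, h5⟩

theorem cyc_glue {P Q : List α} {a b c d : α} (hP : P.IsChain G.Adj) (hQ : Q.IsChain G.Adj)
    (hnP : P.Nodup) (hnQ : Q.Nodup) (hd : ∀ x ∈ P, x ∉ Q) (ha : P.head? = some a)
    (hb : P.getLast? = some b) (hc : Q.head? = some c) (hd' : Q.getLast? = some d)
    (hbc : G.Adj b c) (hda : G.Adj d a) (hlen : 3 ≤ P.length + Q.length) : Cyc G (P ++ Q) := by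
  refine ⟨by simpa using hlen, ?_, ?_⟩
  · rw [List.nodup_append]
    refine ⟨hnP, hnQ, ?_⟩
    rintro x hx y hy rfl
    exact hd x hx hy
  · obtain ⟨P', rfl⟩ : ∃ P', P = a :: P' := by
      cases P with
      | nil => simp at ha
      | cons p P' => exact ⟨P', by simpa using ha⟩
    rw [List.append_assoc, List.isChain_append]
    refine ⟨hP, ?_, ?_⟩
    · rw [List.isChain_append]
      refine ⟨hQ, by simp, ?_⟩
      rw [hd']
      simpa using hda
    · rw [hb, List.head?_append, hc]
      simpa using hbc

theorem Cyc.exists_ne {l : List α} (h : Cyc G l) (a b : α) : ∃ c ∈ l, c ≠ a ∧ c ≠ b := by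
  by_contra! hc
  have hs : l ⊆ [a, b] := fun x hx => by
    by_cases hxa : x = a
    · simp [hxa]
    · simp [hc x hx hxa]
  have := (h.2.1.subperm hs).length_le
  have := h.1
  simp at *
  omega

theorem Str.exists_triple {k : ℕ} {l : List α} {D : Set α} (h : Str G k l D) (hk1 : 1 ≤ k)
    (hk3 : k ≤ 3) : ∃ a ∈ l, ∃ b ∈ l, ∃ c ∈ l, a ≠ b ∧ a ≠ c ∧ b ≠ c ∧
      (∃ d ∈ D, G.Adj d a) ∧ (2 ≤ k → ∃ d ∈ D, G.Adj d b) ∧ (3 ≤ k → ∃ d ∈ D, G.Adj d c) := by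
  have hn := h.2.2.2
  have hfin := att_finite (G := G) l D
  have hc := h.1
  obtain rfl | rfl | rfl : k = 1 ∨ k = 2 ∨ k = 3 := by omega
  · obtain ⟨a, ha⟩ := (Set.ncard_pos hfin).1 (by omega)
    obtain ⟨b, hb, hba, -⟩ := hc.exists_ne a a
    obtain ⟨c, hc, hca, hcb⟩ := hc.exists_ne a b
    exact ⟨a, ha.1, b, hb, c, hc, hba.symm, hca.symm, hcb.symm, ha.2, by simp, by simp⟩
  · obtain ⟨a, b, ha, hb, hab⟩ := (Set.one_lt_ncard_iff hfin).1 (by omega)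
    obtain ⟨c, hc, hca, hcb⟩ := hc.exists_ne a b
    exact ⟨a, ha.1, b, hb.1, c, hc, hab, hca.symm, hcb.symm, ha.2, fun _ => hb.2, by simp⟩
  · obtain ⟨a, b, c, ha, hb, hc, hab, hac, hbc⟩ := (Set.two_lt_ncard_iff hfin).1 (by omega)
    exact ⟨a, ha.1, b, hb.1, c, hc.1, hab, hac, hbc, ha.2, fun _ => hb.2, fun _ => hc.2⟩

theorem hasMinor_of_sets {H : SimpleGraph (Fin 4)} (S : Fin 4 → Set α) (hS : ∀ i, Conn G (S i))
    (hd : ∀ i j, i < j → ∀ x ∈ S i, x ∉ S j)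
    (ha : ∀ i j, i < j → H.Adj i j → ∃ x ∈ S i, ∃ y ∈ S j, G.Adj x y) (x : α)
    (hx : ∀ i, x ∉ S i) : HasMinor (G.induce {y | y ≠ x}) H := by
  have hsub : ∀ i, ∀ y ∈ S i, y ≠ x := by
    rintro i y hy rfl
    exact hx i hy
  refine ⟨fun i => Subtype.val ⁻¹' S i, fun i => ?_, fun i j hij => ?_, fun i => ?_, ?_⟩
  · obtain ⟨y, hy⟩ := (hS i).1
    exact ⟨⟨y, hsub i y hy⟩, hy⟩
  · refine Set.disjoint_left.2 fun y hy hy' => ?_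
    rcases lt_or_gt_of_ne hij with h | h
    · exact hd i j h _ hy hy'
    · exact hd j i h _ hy' hy
  · apply Conn.connected
    obtain ⟨y, hy⟩ := (hS i).1
    refine ⟨⟨⟨y, hsub i y hy⟩, hy⟩, ?_⟩
    rintro A ⟨a, ha, haA⟩ hcl z hz
    have := (hS i).2 (Subtype.val '' A) ⟨a, ha, a, haA, rfl⟩ (by
      rintro _ hb ⟨b, hbA, rfl⟩ c hc hbc
      exact ⟨⟨c, hsub i c hc⟩, hcl b hb hbA ⟨c, hsub i c hc⟩ hc hbc, rfl⟩) hz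
    obtain ⟨w, hw, hwz⟩ := this
    rwa [← Subtype.ext hwz]
  · intro i j hij
    rcases lt_or_gt_of_ne hij.ne with h | h
    · obtain ⟨y, hy, z, hz, hyz⟩ := ha i j h hij
      exact ⟨⟨y, hsub i y hy⟩, hy, ⟨z, hsub j z hz⟩, hz, hyz⟩
    · obtain ⟨y, hy, z, hz, hyz⟩ := ha j i h hij.symm
      exact ⟨⟨z, hsub i z hz⟩, hz, ⟨y, hsub j y hy⟩, hy, hyz.symm⟩

/-- The vertices `0, 1, 2` form a triangle, and `k` (or possibly `k - 1` if `k = 1`) of them,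
in this order, are adjacent to `3`. -/
def Tri (k : ℕ) (H : SimpleGraph (Fin 4)) : Prop :=
  1 ≤ k ∧ k ≤ 3 ∧ H.Adj 0 1 ∧ H.Adj 0 2 ∧ H.Adj 1 2 ∧ (2 ≤ k → H.Adj 0 3) ∧
    (H.Adj 1 3 ↔ 2 ≤ k) ∧ (H.Adj 2 3 ↔ 3 ≤ k)

theorem Str.hasMinor {k : ℕ} {H : SimpleGraph (Fin 4)} (hH : Tri k H) {l : List α} {D : Set α}
    (h : Str G k l D) {x : α} (hx : ¬ (x ∈ l ∨ x ∈ D)) : HasMinor (G.induce {y | y ≠ x}) H := by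
  obtain ⟨hk1, hk3, -, -, -, -, h13, h23⟩ := hH
  obtain ⟨a, ha, b, hb, c, hc, hab, hac, hbc, h1, h2, h3⟩ := h.exists_triple hk1 hk3
  obtain ⟨A, B, C, hcyc, hp⟩ := h.1.exists_three ha hb hc hab hac hbc
  obtain ⟨hcyc, hD, hdis, -⟩ := h.of_perm hcyc hp
  have hx1 : x ∉ a :: A ++ b :: (B ++ c :: C) := fun h' => hx (Or.inl (hp.mem_iff.1 h'))
  have hx2 : x ∉ D := fun h' => hx (Or.inr h')
  clear hx hp h ha hb hc
  have hnd := hcyc.2.1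
  have h5 := cyc_split.1 hcyc
  have h4 : (a :: A ++ b :: (B ++ c :: C) ++ [a]).IsChain G.Adj := hcyc.2.2
  have hAB : ((a :: A) ++ [b]).IsChain G.Adj := h5.2.2.1
  have h5' : (b :: (B ++ c :: C) ++ [a]).IsChain G.Adj := h5.2.2.2
  have h6 : b :: (B ++ c :: C) ++ [a] = (b :: B) ++ c :: (C ++ [a]) := by simp
  rw [h6, List.isChain_split] at h5'
  have hBC : ((b :: B) ++ [c]).IsChain G.Adj := h5'.1
  have hCA : ((c :: C) ++ [a]).IsChain G.Adj := h5'.2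
  have key : ∀ (P : List α) (z : α), P ≠ [] → (P ++ [z]).IsChain G.Adj →
      P.IsChain G.Adj ∧ ∃ y ∈ P, G.Adj y z := by
    intro P z hP hch
    obtain ⟨Q, y, rfl⟩ := (List.eq_nil_or_concat' P).resolve_left hP
    refine ⟨(List.isChain_append.1 hch).1, y, by simp, ?_⟩
    rw [List.append_assoc, List.singleton_append, List.isChain_append_cons_cons] at hch
    exact hch.2.1
  obtain ⟨hA, a', ha', haa⟩ := key _ _ (by simp) hAB
  obtain ⟨hB, b', hb', hbb⟩ := key _ _ (by simp) hBC
  obtain ⟨hC, c', hc', hcc⟩ := key _ _ (by simp) hCA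
  refine hasMinor_of_sets ![{y | y ∈ a :: A}, {y | y ∈ b :: B}, {y | y ∈ c :: C}, D] ?_ ?_ ?_ x ?_
  · intro i
    fin_cases i
    · exact conn_list (by simp) hA
    · exact conn_list (by simp) hB
    · exact conn_list (by simp) hC
    · exact hD
  · simp only [List.nodup_append, List.nodup_cons, List.cons_append] at hnd
    intro i j hij y hy hy'
    fin_cases i <;> fin_cases j <;> simp at hij <;> simp at hy hy' hdis hnd <;> grind
  · intro i j hij hadj
    fin_cases i <;> fin_cases j <;> try exact absurd hij (by decide)
    · exact ⟨a', ha', b, by simp, haa⟩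
    · exact ⟨a, by simp, c', hc', hcc.symm⟩
    · obtain ⟨d, hd, hda⟩ := h1
      exact ⟨a, by simp, d, hd, hda.symm⟩
    · exact ⟨b', hb', c, by simp, hbb⟩
    · obtain ⟨d, hd, hda⟩ := h2 (h13.1 hadj)
      exact ⟨b, by simp, d, hd, hda.symm⟩
    · obtain ⟨d, hd, hda⟩ := h3 (h23.1 hadj)
      exact ⟨c, by simp, d, hd, hda.symm⟩
  · intro i hi
    simp at hx1
    fin_cases i <;> simp at hi <;> grind

theorem exists_str_of_hasMinor {k : ℕ} {H : SimpleGraph (Fin 4)} (hH : Tri k H)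
    (hG : G.Connected) (hm : HasMinor G H) : ∃ l D, Str G k l D := by
  obtain ⟨V, hne, hdis, hcon, hadj⟩ := hm
  obtain ⟨hk1, hk3, h01, h02, h12, h03, h13, h23⟩ := hH
  have hV : ∀ i, Conn G (V i) := fun i => conn_of_connected (hcon i)
  have hdis' : ∀ i j, i ≠ j → ∀ x ∈ V i, x ∉ V j := fun i j hij x hx hx' =>
    Set.disjoint_left.1 (hdis hij) hx hx'
  obtain ⟨a2, ha2, b1, hb1, hab⟩ := hadj 0 1 h01
  obtain ⟨b2, hb2, c1, hc1, hbc⟩ := hadj 1 2 h12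
  obtain ⟨a1, ha1, c2, hc2, hac⟩ := hadj 0 2 h02
  obtain ⟨P, hP1, hP2, hPS, hPc, hPn, -⟩ := (hV 0).exists_list ha1 ha2
  obtain ⟨Q, hQ1, hQ2, hQS, hQc, hQn, -⟩ := (hV 1).exists_list hb1 hb2
  obtain ⟨R, hR1, hR2, hRS, hRc, hRn, -⟩ := (hV 2).exists_list hc1 hc2
  have hPne := List.length_pos_iff.2 (show P ≠ [] by rintro rfl; simp at hP1)
  have hQne := List.length_pos_iff.2 (show Q ≠ [] by rintro rfl; simp at hQ1)
  have hRne := List.length_pos_iff.2 (show R ≠ [] by rintro rfl; simp at hR1)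
  have hcyc : Cyc G ((P ++ Q) ++ R) := by
    refine cyc_glue (a := a1) (b := b2) (c := c1) (d := c2) ?_ hRc ?_ hRn ?_ ?_ ?_ hR1 hR2 hbc
      hac.symm ?_
    · rw [List.isChain_append]
      refine ⟨hPc, hQc, ?_⟩
      rw [hP2, hQ1]
      simpa using hab
    · rw [List.nodup_append]
      refine ⟨hPn, hQn, ?_⟩
      rintro x hx y hy rfl
      exact hdis' 0 1 (by decide) x (hPS x hx) (hQS x hy)
    · intro x hx hxR
      rw [List.mem_append] at hx
      rcases hx with hx | hx
      · exact hdis' 0 2 (by decide) x (hPS x hx) (hRS x hxR)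
      · exact hdis' 1 2 (by decide) x (hQS x hx) (hRS x hxR)
    · rw [List.head?_append, hP1]
      rfl
    · rw [List.getLast?_append, hQ2]
      rfl
    · simp only [List.length_append]
      omega
  generalize hl : (P ++ Q) ++ R = l at hcyc
  have hlV : ∀ x ∈ l, x ∉ V 3 := by
    intro x hx hx3
    rw [← hl, List.mem_append, List.mem_append] at hx
    rcases hx with (hx | hx) | hx
    · exact hdis' 0 3 (by decide) x (hPS x hx) hx3
    · exact hdis' 1 3 (by decide) x (hQS x hx) hx3
    · exact hdis' 2 3 (by decide) x (hRS x hx) hx3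
  -- the component of `V 3` in the complement of the cycle
  obtain ⟨v, hv⟩ := (hV 3).1
  obtain ⟨D, hDc, hD3, hDl, hDcl⟩ : ∃ D : Set α, Conn G D ∧ V 3 ⊆ D ∧ (∀ x ∈ l, x ∉ D) ∧
      ∀ a ∈ D, ∀ b, G.Adj a b → b ∉ D → b ∈ l := by
    let D : Set α := ⋃₀ {S | Conn G S ∧ V 3 ⊆ S ∧ ∀ x ∈ l, x ∉ S}
    have hsub : V 3 ⊆ D := Set.subset_sUnion_of_mem ⟨hV 3, subset_rfl, hlV⟩
    refine ⟨D, ⟨⟨v, hsub hv⟩, ?_⟩, hsub, ?_, ?_⟩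
    · rintro A ⟨a, ⟨S, hS, haS⟩, haA⟩ hcl w ⟨T, hT, hwT⟩
      have h1 : S ⊆ A := hS.1.2 A ⟨a, haS, haA⟩ fun x hx hxA y hy hxy =>
        hcl x ⟨S, hS, hx⟩ hxA y ⟨S, hS, hy⟩ hxy
      have h2 : T ⊆ A := hT.1.2 A ⟨v, hT.2.1 hv, h1 (hS.2.1 hv)⟩ fun x hx hxA y hy hxy =>
        hcl x ⟨T, hT, hx⟩ hxA y ⟨T, hT, hy⟩ hxy
      exact h2 hwT
    · rintro x hx ⟨S, hS, hxS⟩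
      exact hS.2.2 x hx hxS
    · rintro a ⟨S, hS, haS⟩ b hab hbD
      by_contra hbl
      refine hbD ⟨S ∪ {b}, ⟨hS.1.union_adj (conn_singleton b) haS rfl hab,
        hS.2.1.trans Set.subset_union_left, ?_⟩, Or.inr rfl⟩
      rintro x hx (hxS | rfl)
      · exact hS.2.2 x hx hxS
      · exact hbl hx
  have hatt : ∀ i, (∃ x ∈ l, x ∈ V i) → H.Adj i 3 → ∃ x ∈ l, x ∈ V i ∧ ∃ d ∈ D, G.Adj d x := by
    rintro i ⟨x, hxl, hxi⟩ hi3
    obtain ⟨y, hy, z, hz, hyz⟩ := hadj i 3 hi3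
    by_cases hyD : y ∈ D
    · obtain ⟨p, hp, hpD, q, hq, hqD, hpq⟩ := (hV i).exists_crossing D ⟨y, hy, hyD⟩
        ⟨x, hxi, hDl x hxl⟩
      exact ⟨q, hDcl p hpD q hpq hqD, hq, p, hpD, hpq⟩
    · exact ⟨y, hDcl z (hD3 hz) y hyz.symm hyD, hy, z, hD3 hz, hyz.symm⟩
  have hm0 : ∃ x ∈ l, x ∈ V 0 := by
    have := List.mem_of_mem_head? (hP1 ▸ rfl : a1 ∈ P.head?)
    exact ⟨a1, by simp [← hl, this], ha1⟩
  have hm1 : ∃ x ∈ l, x ∈ V 1 := by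
    have := List.mem_of_mem_head? (hQ1 ▸ rfl : b1 ∈ Q.head?)
    exact ⟨b1, by simp [← hl, this], hb1⟩
  have hm2 : ∃ x ∈ l, x ∈ V 2 := by
    have := List.mem_of_mem_head? (hR1 ▸ rfl : c1 ∈ R.head?)
    exact ⟨c1, by simp [← hl, this], hc1⟩
  have hfin := att_finite (G := G) l D
  refine ⟨l, D, hcyc, hDc, hDl, ?_⟩
  obtain rfl | rfl | rfl : k = 1 ∨ k = 2 ∨ k = 3 := by omega
  · obtain ⟨x, hx, -⟩ := hm0
    have hGc : Conn G Set.univ := by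
      refine conn_of_connected ?_
      exact (induceUnivIso G).connected_iff.2 hG
    obtain ⟨p, -, hp, q, -, hq, hpq⟩ := hGc.exists_crossing D ⟨v, trivial, hD3 hv⟩
      ⟨x, trivial, hDl x hx⟩
    exact (Set.ncard_pos hfin).2 ⟨q, hDcl p hp q hpq hq, p, hp, hpq⟩
  · obtain ⟨x, hx, hx0, hxD⟩ := hatt 0 hm0 (h03 le_rfl)
    obtain ⟨y, hy, hy1, hyD⟩ := hatt 1 hm1 (h13.2 le_rfl)
    refine (Set.one_lt_ncard_iff hfin).2 ⟨x, y, ⟨hx, hxD⟩, ⟨hy, hyD⟩, ?_⟩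
    rintro rfl
    exact hdis' 0 1 (by decide) x hx0 hy1
  · obtain ⟨x, hx, hx0, hxD⟩ := hatt 0 hm0 (h03 (by omega))
    obtain ⟨y, hy, hy1, hyD⟩ := hatt 1 hm1 (h13.2 (by omega))
    obtain ⟨z, hz, hz1, hzD⟩ := hatt 2 hm2 (h23.2 le_rfl)
    refine le_ncard_att le_rfl hx hy hz ?_ ?_ ?_ hxD hyD hzD
    · rintro rfl
      exact hdis' 0 1 (by decide) x hx0 hy1
    · rintro rfl
      exact hdis' 0 2 (by decide) x hx0 hz1
    · rintro rfl
      exact hdis' 1 2 (by decide) y hy1 hz1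

theorem Ind.nbrs {P : List α} (h : Ind G P) (hn : P.Nodup) {a b : α}
    (ha : ∀ x ∈ P, G.Adj x a → P.head? = some x) (hb : ∀ x ∈ P, G.Adj x b → P.getLast? = some x)
    {x : α} (hx : x ∈ P) :
    ∃ y z, ∀ w, w ∈ P ∨ w = a ∨ w = b → G.Adj x w → w = y ∨ w = z := by
  obtain ⟨A, B, rfl⟩ := List.append_of_mem hx
  have hA : ∃ y, ∀ w, w ∈ A ∨ w = a → G.Adj x w → w = y := by
    rcases List.eq_nil_or_concat' A with rfl | ⟨A', y, rfl⟩
    · exact ⟨a, by simp⟩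
    · refine ⟨y, ?_⟩
      rintro w (hw | rfl) hxw
      · rw [List.mem_append, List.mem_singleton] at hw
        rcases hw with hw | rfl
        · obtain ⟨A1, A2, rfl⟩ := List.append_of_mem hw
          have := h A1 w (A2 ++ [y]) x B (by simp) hxw.symm
          simp at this
        · rfl
      · have h1 := ha x (by simp) hxw
        have hx' : x ∈ A' ++ [y] := by
          rw [List.head?_append_of_ne_nil _ (by simp)] at h1
          exact List.mem_of_mem_head? h1
        rw [List.nodup_append] at hn
        exact absurd rfl (hn.2.2 x hx' x (by simp))
  have hB : ∃ z, ∀ w, w ∈ B ∨ w = b → G.Adj x w → w = z := by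
    cases B with
    | nil => exact ⟨b, by simp⟩
    | cons z B' =>
      refine ⟨z, ?_⟩
      rintro w (hw | rfl) hxw
      · rw [List.mem_cons] at hw
        rcases hw with rfl | hw
        · rfl
        · obtain ⟨A1, A2, rfl⟩ := List.append_of_mem hw
          have := h A x (z :: A1) w A2 (by simp) hxw
          simp at this
      · have h1 := hb x (by simp) hxw
        have hx' : x ∈ z :: B' := by
          have h2 : A ++ x :: z :: B' = (A ++ [x]) ++ z :: B' := by simp
          rw [h2, List.getLast?_append_of_ne_nil _ (by simp)] at h1
          exact List.mem_of_mem_getLast? h1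
        have h3 := (List.nodup_append.1 hn).2.1
        rw [List.nodup_cons] at h3
        exact absurd hx' h3.1
  obtain ⟨y, hy⟩ := hA
  obtain ⟨z, hz⟩ := hB
  refine ⟨y, z, fun w hw hxw => ?_⟩
  simp only [List.mem_append, List.mem_cons] at hw
  rcases hw with (hw | rfl | hw) | hw | hw
  · exact Or.inl (hy w (Or.inl hw) hxw)
  · exact absurd hxw G.irrefl
  · exact Or.inr (hz w (Or.inl hw) hxw)
  · exact Or.inl (hy w (Or.inr hw) hxw)
  · exact Or.inr (hz w (Or.inr hw) hxw)

theorem isCycleGraph_induce {l : List α} (h : Cyc G l) {w : α} (hl : ∀ x, x ∈ l ↔ x ≠ w)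
    (hdeg : ∀ x ∈ l, ∃ y z, ∀ v ∈ l, G.Adj x v → v = y ∨ v = z) :
    IsCycleGraph (G.induce {u | u ≠ w}) := by
  have hset : {x | x ∈ l} = {u | u ≠ w} := by
    ext x
    exact hl x
  refine ⟨?_, ?_⟩
  · rw [← hset]
    exact (conn_list h.ne_nil h.chain).connected
  · rintro ⟨x, hx⟩
    have hxl := (hl x).2 hx
    obtain ⟨y, z, M, -, hp, hyz, hxy, hxz⟩ := h.exists_nbrs hxl
    obtain ⟨y', z', hyz'⟩ := hdeg x hxl
    have hy : y ∈ l := hp.mem_iff.1 (by simp)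
    have hz : z ∈ l := hp.mem_iff.1 (by simp)
    rw [Set.ncard_eq_two]
    refine ⟨⟨y, (hl y).1 hy⟩, ⟨z, (hl z).1 hz⟩, fun e => hyz (congrArg Subtype.val e), ?_⟩
    ext ⟨v, hv⟩
    simp only [mem_neighborSet, comap_adj, Function.Embedding.subtype_apply, Set.mem_insert_iff,
      Set.mem_singleton_iff, Subtype.mk.injEq]
    constructor
    · intro hxv
      have h1 := hyz' v ((hl v).2 hv) hxv
      have h2 := hyz' y hy hxy
      have h3 := hyz' z hz hxz
      grind
    · rintro (rfl | rfl)
      · exact hxy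
      · exact hxz

theorem Chordless.nbrs {l : List α} (h : Chordless G l) {x : α} (hx : x ∈ l) :
    ∃ y z, ∀ v ∈ l, G.Adj x v → v = y ∨ v = z := by
  obtain ⟨y, -, z, -, -, -, -, h⟩ := h x hx
  exact ⟨y, z, h⟩

theorem Str.isCycleGraph {k : ℕ} {l : List α} {D : Set α} (h : Str G k l D)
    (hc : Chordless G l) (hcov : ∀ x, x ∈ l ∨ x ∈ D) {w : α} (hD : D = {w}) :
    IsCycleGraph (G.induce {u | u ≠ w}) := by
  refine isCycleGraph_induce h.1 (fun x => ⟨?_, ?_⟩) fun x hx => hc.nbrs hx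
  · rintro hx rfl
    exact h.2.2.1 x hx (by simp [hD])
  · intro hx
    refine (hcov x).resolve_right ?_
    rw [hD]
    exact hx

/-- A cycle vertex without neighbours off the cycle has only two neighbours. -/
theorem Chordless.nbrs_of_notMem_att {l : List α} {D : Set α} (hc : Chordless G l)
    (hcov : ∀ x, x ∈ l ∨ x ∈ D) {x : α} (hx : x ∈ l) (hxD : x ∉ att G l D) :
    ∃ y z, ∀ w, G.Adj x w → w = y ∨ w = z := by
  obtain ⟨y, z, hyz⟩ := hc.nbrs hx
  refine ⟨y, z, fun w hxw => ?_⟩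
  rcases hcov w with hw | hw
  · exact hyz w hw hxw
  · exact absurd ⟨hx, w, hw, hxw.symm⟩ hxD

theorem Str.ncard_att_lt {k : ℕ} {l : List α} {D : Set α} (h : Str G k l D)
    (hcov : ∀ l D, Str G k l D → ∀ x, x ∈ l ∨ x ∈ D) {D' : Set α} (hD' : Conn G D')
    (hsub : D' ⊆ D) {z : α} (hz : z ∈ D) (hz' : z ∉ D') : (att G l D').ncard < k := by
  by_contra! hk
  have hs : Str G k l D' := ⟨h.1, hD', fun x hx hx' => h.2.2.1 x hx (hsub hx'), hk⟩
  rcases hcov l D' hs z with hzl | hzD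
  · exact h.2.2.1 z hzl hz
  · exact hz' hzD

theorem Str.exists_private {k : ℕ} {l : List α} {D : Set α} (h : Str G k l D)
    (hcov : ∀ l D, Str G k l D → ∀ x, x ∈ l ∨ x ∈ D) {D' : Set α} (hD' : Conn G D')
    (hsub : D' ⊆ D) {z : α} (hz : z ∈ D) (hz' : z ∉ D') (hDz : ∀ x ∈ D, x = z ∨ x ∈ D') :
    ∃ t ∈ l, G.Adj z t ∧ t ∉ att G l D' ∧ ∀ x ∈ D, G.Adj x t → x = z := by
  have hlt := h.ncard_att_lt hcov hD' hsub hz hz'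
  obtain ⟨t, ⟨htl, d, hd, hdt⟩, ht⟩ := Set.exists_mem_notMem_of_ncard_lt_ncard
    (hlt.trans_le h.2.2.2) (att_finite _ _)
  have huniq : ∀ x ∈ D, G.Adj x t → x = z := fun x hx hxt =>
    (hDz x hx).resolve_right fun hx' => ht ⟨htl, x, hx', hxt⟩
  exact ⟨t, htl, huniq d hd hdt ▸ hdt, ht, huniq⟩

/-- In a structure with shortest cycle, a vertex off the cycle with two neighbours on it
cuts the cycle into short arcs. -/
theorem Str.arc_le {l : List α} {D : Set α} (h : Str G 3 l D)
    (hmin : ∀ l' D', Str G 3 l' D' → l.length ≤ l'.length) {q a a' c : α} {A A' : List α}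
    (hp : (a :: A ++ a' :: A').Perm l) (hcyc : Cyc G (a :: A ++ a' :: A'))
    (hqa : G.Adj q a) (hqa' : G.Adj q a') {D' : Set α} (hD' : Conn G D') (hsub : D' ⊆ D)
    (hq : q ∈ D) (hqD' : q ∉ D') (hqadj : ∃ d ∈ D', G.Adj d q) (hc : c ∈ A)
    (hcadj : ∃ d ∈ D', G.Adj d c) : A.length ≤ 1 := by
  have hnd := hcyc.2.1
  have hdis : ∀ x ∈ a :: A ++ a' :: A', x ∉ D := fun x hx => h.2.2.1 x (hp.mem_iff.1 hx)
  rw [cyc_split] at hcyc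
  obtain ⟨-, -, hch1, hch2⟩ := hcyc
  have hA : A ≠ [] := List.ne_nil_of_mem hc
  obtain ⟨A1, y, hA1⟩ := (List.eq_nil_or_concat' A).resolve_left hA
  obtain ⟨x, A2, hA2⟩ := List.exists_cons_of_ne_nil hA
  have hax : G.Adj a x := by
    rw [hA2] at hch1
    simp at hch1
    exact hch1.1
  have hya : G.Adj y a' := by
    have h3 : a :: A ++ [a'] = (a :: A1) ++ y :: [a'] := by simp [hA1]
    rw [h3, List.isChain_split] at hch1
    simpa using hch1.2
  have hchA : A.IsChain G.Adj := by
    rw [List.cons_append, List.isChain_cons, List.isChain_append] at hch1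
    exact hch1.2.1
  have hs : Str G 3 (q :: (a' :: A') ++ [a]) (D' ∪ {x | x ∈ A}) := by
    refine ⟨?_, ?_, ?_, ?_⟩
    · rw [cyc_split]
      refine ⟨by simp, ?_, ?_, by simpa using hqa.symm⟩
      · have h1 : q ∉ a :: A ++ a' :: A' := fun hq' => hdis q hq' hq
        simp only [List.nodup_append, List.nodup_cons] at hnd
        simp at hnd h1 ⊢
        simp only [List.nodup_append]
        simp
        grind
      · rw [List.cons_append, List.cons_append, List.isChain_cons_cons]
        exact ⟨hqa', hch2⟩
    · obtain ⟨d, hd, hdc⟩ := hcadj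
      exact hD'.union_adj (conn_list hA hchA) hd hc hdc
    · intro w hw
      simp only [List.nodup_append, List.nodup_cons] at hnd
      have h1 : ∀ x ∈ A, x ≠ q := by
        rintro x hx rfl
        exact hdis x (by simp [hx]) hq
      have h2 : w ∈ D' → w ∈ D := fun h => hsub h
      have h3 := hdis w
      simp at hw hnd h3 ⊢
      grind
    · obtain ⟨d, hd, hdq⟩ := hqadj
      have hne : a ≠ a' := by
        simp only [List.nodup_append, List.nodup_cons] at hnd
        simp at hnd
        grind
      exact le_ncard_att le_rfl (a := a) (b := a') (c := q) (by simp) (by simp) (by simp) hne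
        hqa.ne' hqa'.ne' ⟨x, Or.inr (by simp [hA2]), hax.symm⟩
        ⟨y, Or.inr (by simp [hA1]), hya⟩ ⟨d, Or.inl hd, hdq⟩
  have h1 := hmin _ _ hs
  rw [← hp.length_eq] at h1
  simp only [List.length_append, List.length_cons, List.length_nil] at h1
  omega

/-- A recognition lemma for `K_{3,3}`. -/
theorem nonempty_iso_k33 {a₁ a₂ a₃ b₁ b₂ b₃ : α} (hnd : [a₁, a₂, a₃, b₁, b₂, b₃].Nodup)
    (hcov : ∀ x, x ∈ [a₁, a₂, a₃, b₁, b₂, b₃])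
    (hadj : ∀ a ∈ [a₁, a₂, a₃], ∀ b ∈ [b₁, b₂, b₃], G.Adj a b)
    (ha : ∀ a ∈ [a₁, a₂, a₃], ∀ b ∈ [a₁, a₂, a₃], ¬ G.Adj a b)
    (hb : ∀ a ∈ [b₁, b₂, b₃], ∀ b ∈ [b₁, b₂, b₃], ¬ G.Adj a b) :
    Nonempty (G ≃g completeBipartiteGraph (Fin 3) (Fin 3)) := by
  let f : Fin 3 ⊕ Fin 3 → α := Sum.elim ![a₁, a₂, a₃] ![b₁, b₂, b₃]
  have hl : ∀ i, f (Sum.inl i) ∈ [a₁, a₂, a₃] := by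
    intro i; fin_cases i <;> simp [f]
  have hr : ∀ i, f (Sum.inr i) ∈ [b₁, b₂, b₃] := by
    intro i; fin_cases i <;> simp [f]
  have hinj : Function.Injective f := by
    simp at hnd
    rintro (i | i) (j | j) hij <;> fin_cases i <;> fin_cases j <;> simp [f] at hij ⊢ <;> grind
  have hsurj : Function.Surjective f := by
    intro x
    have := hcov x
    simp at this
    rcases this with rfl | rfl | rfl | rfl | rfl | rfl
    · exact ⟨Sum.inl 0, rfl⟩
    · exact ⟨Sum.inl 1, rfl⟩
    · exact ⟨Sum.inl 2, rfl⟩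
    · exact ⟨Sum.inr 0, rfl⟩
    · exact ⟨Sum.inr 1, rfl⟩
    · exact ⟨Sum.inr 2, rfl⟩
  have key : ∀ x y, G.Adj (f x) (f y) ↔ (completeBipartiteGraph (Fin 3) (Fin 3)).Adj x y := by
    rintro (i | i) (j | j)
    · simpa using ha _ (hl i) _ (hl j)
    · simpa using hadj _ (hl i) _ (hr j)
    · simpa using (hadj _ (hl j) _ (hr i)).symm
    · simpa using hb _ (hr i) _ (hr j)
  exact ⟨RelIso.symm ⟨Equiv.ofBijective f ⟨hinj, hsurj⟩, fun {x y} => key x y⟩⟩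

/-- If exactly one vertex on the cycle, `t`, is attached to the interior of the path `Q`, then it
is the hub of a cycle. -/
theorem Str.isCycleGraph_hub {l Q : List α} (h : Str G 3 l {x | x ∈ Q}) (hc : Chordless G l)
    (hcov : ∀ l D, Str G 3 l D → ∀ x, x ∈ l ∨ x ∈ D)
    (h6 : ∀ S : Set α, S.ncard ≤ 5 → ∃ x ∉ S, ∀ y z, ∃ w, G.Adj x w ∧ w ≠ y ∧ w ≠ z)
    (hQ : Q.IsChain G.Adj) (hQn : Q.Nodup) (hQi : Ind G Q) {p q a b t : α}
    (hp : Q.head? = some p) (hq : Q.getLast? = some q) (ha : a ∈ l) (hb : b ∈ l) (ht : t ∈ l)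
    (hta : t ≠ a) (htb : t ≠ b) (hab : a ≠ b) (hpa : ∀ x ∈ Q, G.Adj x a ↔ x = p)
    (hqb : ∀ x ∈ Q, G.Adj x b ↔ x = q) (hatt : att G l {x | x ∈ Q} ⊆ {a, b, t}) :
    IsCycleGraph (G.induce {u | u ≠ t}) := by
  have hcov' := hcov _ _ h
  have hpQ : p ∈ Q := List.mem_of_mem_head? (hp ▸ rfl)
  have hqQ : q ∈ Q := List.mem_of_mem_getLast? (hq ▸ rfl)
  have hdis : ∀ x ∈ l, x ∉ Q := h.2.2.1
  have hQnbrs : ∀ x ∈ Q, ∃ y z, ∀ w, w ≠ t → G.Adj x w → w = y ∨ w = z := by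
    intro x hx
    obtain ⟨y, z, hyz⟩ := hQi.nbrs hQn (a := a) (b := b)
      (fun x hx hxa => by rw [(hpa x hx).1 hxa, hp])
      (fun x hx hxb => by rw [(hqb x hx).1 hxb, hq]) hx
    refine ⟨y, z, fun w hwt hxw => hyz w ?_ hxw⟩
    rcases hcov' w with hw | hw
    · have := hatt ⟨hw, x, hx, hxw⟩
      simp [hwt] at this
      exact Or.inr this
    · exact Or.inl hw
  have hN : 3 ≤ {x | x ∈ Q ∧ G.Adj x t}.ncard := by
    by_contra! hlt
    obtain ⟨x, hx, hx3⟩ := h6 ({a, b, t} ∪ {x | x ∈ Q ∧ G.Adj x t}) (by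
      have h1 := Set.ncard_union_le {a, b, t} {x | x ∈ Q ∧ G.Adj x t}
      have h2 : ({a, b, t} : Set α).ncard ≤ 3 := by
        have := Set.ncard_insert_le a {b, t}
        have := Set.ncard_insert_le b {t}
        have := Set.ncard_singleton t
        omega
      omega)
    rw [Set.mem_union, not_or] at hx
    rcases hcov' x with hxl | hxQ
    · obtain ⟨y, z, hyz⟩ := hc.nbrs_of_notMem_att hcov' hxl fun h => hx.1 (hatt h)
      obtain ⟨w, hw, hwy, hwz⟩ := hx3 y z
      have := hyz w hw
      tauto
    · obtain ⟨y, z, hyz⟩ := hQnbrs x hxQ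
      obtain ⟨w, hw, hwy, hwz⟩ := hx3 y z
      by_cases hwt : w = t
      · exact hx.2 ⟨hxQ, hwt ▸ hw⟩
      · have := hyz w hwt hw
        tauto
  obtain ⟨A, B, C, hcyc, hperm⟩ := h.1.exists_three ht ha hb hta htb hab
  have hnd := hcyc.2.1
  have hmem := fun x => hperm.mem_iff (a := x)
  have hcyc2 := hcyc
  have hcyc3 : Cyc G (t :: (A ++ a :: B) ++ b :: C) := by simpa using hcyc
  rw [cyc_split] at hcyc2
  rw [cyc_split] at hcyc3
  have hchab : (a :: B ++ [b]).IsChain G.Adj := by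
    have := hcyc2.2.2.2
    have h3 : a :: (B ++ b :: C) ++ [t] = (a :: B) ++ b :: (C ++ [t]) := by simp
    rw [h3, List.isChain_split] at this
    exact this.1
  have hs : Str G 3 (a :: B ++ b :: Q.reverse) {t} := by
    refine ⟨?_, conn_singleton t, ?_, ?_⟩
    · rw [cyc_split]
      refine ⟨?_, ?_, hchab, ?_⟩
      · have := List.length_pos_iff.2 (List.ne_nil_of_mem hpQ)
        simp only [List.length_append, List.length_cons, List.length_reverse]
        omega
      · have h1 : ∀ x ∈ a :: (B ++ [b]), x ∉ Q := fun x hx => hdis x ((hmem x).1 (by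
          simp at hx ⊢; tauto))
        simp only [List.nodup_append, List.nodup_cons, List.cons_append] at hnd ⊢
        simp at hnd h1 ⊢
        grind
      · rw [List.cons_append, List.isChain_cons, List.isChain_append]
        refine ⟨?_, chain_reverse hQ, by simp, ?_⟩
        · have : (Q.reverse ++ [a]).head? = some q := by
            rw [List.head?_append, List.head?_reverse, hq]
            rfl
          rw [this]
          rintro y hy
          obtain rfl : q = y := by simpa using hy
          exact ((hqb _ hqQ).2 rfl).symm
        · rw [List.getLast?_reverse, hp]
          intro x hx y hy
          obtain rfl : p = x := by simpa using hx
          obtain rfl : a = y := by simpa using hy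
          exact (hpa _ hpQ).2 rfl
    · intro x hx hxt
      obtain rfl : x = t := hxt
      have := hdis x ht
      simp only [List.nodup_append, List.nodup_cons, List.cons_append] at hnd
      simp at hnd hx
      grind
    · refine hN.trans (Set.ncard_le_ncard ?_ (att_finite _ _))
      rintro x ⟨hx, hxt⟩
      exact ⟨by simp [hx], t, rfl, hxt.symm⟩
  have hcov2 := hcov _ _ hs
  have hA : A = [] := by
    rw [List.eq_nil_iff_forall_not_mem]
    intro x hx
    have h1 := hcov2 x
    have h2 := hdis x ((hmem x).1 (by simp [hx]))
    simp only [List.nodup_append, List.nodup_cons, List.cons_append] at hnd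
    simp at hnd h1
    grind
  have hC : C = [] := by
    rw [List.eq_nil_iff_forall_not_mem]
    intro x hx
    have h1 := hcov2 x
    have h2 := hdis x ((hmem x).1 (by simp [hx]))
    simp only [List.nodup_append, List.nodup_cons, List.cons_append] at hnd
    simp at hnd h1
    grind
  have hadta : G.Adj t a := by simpa [hA] using hcyc2.2.2.1
  have hadbt : G.Adj b t := by simpa [hC] using hcyc3.2.2.2
  have hlQ : ∀ x ∈ l, ∀ d : α, (∀ w ∈ Q, G.Adj x w → w = d) → (x ≠ t → ¬ G.Adj x t →
      x ∉ att G l {x | x ∈ Q}) → x ≠ t →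
      ∃ y z, ∀ w, w ≠ t → G.Adj x w → w = y ∨ w = z := by
    intro x hx d hd hno hxt
    obtain ⟨y, z, hyz⟩ := hc.nbrs hx
    by_cases hadj : G.Adj x t
    · rcases hyz t ht hadj with rfl | rfl
      · refine ⟨z, d, fun w hw hxw => ?_⟩
        rcases hcov' w with hwl | hwQ
        · exact Or.inl ((hyz w hwl hxw).resolve_left hw)
        · exact Or.inr (hd w hwQ hxw)
      · refine ⟨y, d, fun w hw hxw => ?_⟩
        rcases hcov' w with hwl | hwQ
        · exact Or.inl ((hyz w hwl hxw).resolve_right hw)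
        · exact Or.inr (hd w hwQ hxw)
    · obtain ⟨y, z, hyz⟩ := hc.nbrs_of_notMem_att hcov' hx (hno hxt hadj)
      exact ⟨y, z, fun w _ => hyz w⟩
  refine isCycleGraph_induce hs.1 (fun x => ⟨fun hx hxt => hs.2.2.1 x hx hxt,
    fun hx => (hcov2 x).resolve_right hx⟩) fun x hx => ?_
  have hxt : x ≠ t := fun hxt => hs.2.2.1 x hx hxt
  suffices ∃ y z, ∀ w, w ≠ t → G.Adj x w → w = y ∨ w = z by
    obtain ⟨y, z, hyz⟩ := this
    exact ⟨y, z, fun v hv => hyz v fun hvt => hs.2.2.1 v hv hvt⟩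
  rcases hcov' x with hxl | hxQ
  · by_cases hxa : x = a
    · subst hxa
      exact hlQ x hxl p (fun w hw hxw => (hpa w hw).1 hxw.symm)
        (fun _ hn => absurd hadta.symm hn) hxt
    · by_cases hxb : x = b
      · subst hxb
        exact hlQ x hxl q (fun w hw hxw => (hqb w hw).1 hxw.symm)
          (fun _ hn => absurd hadbt hn) hxt
      · obtain ⟨y, z, hyz⟩ := hc.nbrs_of_notMem_att hcov' hxl (fun h => by
          have := hatt h
          simp [hxa, hxb, hxt] at this)
        exact ⟨y, z, fun w _ => hyz w⟩
  · exact hQnbrs x hxQ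

/-- The end of the analysis of the case in which both ends of the path have two neighbours. -/
theorem Str.nonempty_iso_k33 {l M : List α} {p q a₁ a₂ b₁ b₂ : α}
    (h : Str G 3 l {x | x ∈ p :: M ++ [q]}) (hc : Chordless G l)
    (hcov : ∀ l D, Str G 3 l D → ∀ x, x ∈ l ∨ x ∈ D) (hQ : (p :: M ++ [q]).IsChain G.Adj)
    (hQn : (p :: M ++ [q]).Nodup) (hperm : [a₁, b₁, a₂, b₂].Perm l)
    (hcyc : Cyc G [a₁, b₁, a₂, b₂])
    (hadj : ∀ x ∈ p :: M ++ [q], ∀ y ∈ l, G.Adj x y ↔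
      (x = p ∧ (y = a₁ ∨ y = a₂)) ∨ (x = q ∧ (y = b₁ ∨ y = b₂))) :
    Nonempty (G ≃g completeBipartiteGraph (Fin 3) (Fin 3)) := by
  have hmem : ∀ x, x ∈ l ↔ x = a₁ ∨ x = b₁ ∨ x = a₂ ∨ x = b₂ := fun x => by
    rw [← hperm.mem_iff]; simp
  have hnd := hcyc.2.1
  obtain ⟨-, -, hch⟩ := hcyc
  have hdis : ∀ x ∈ l, x ∉ p :: M ++ [q] := h.2.2.1
  have hcov' : ∀ x, x ∈ l ∨ x ∈ p :: M ++ [q] := hcov _ _ h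
  have hp : p ∈ p :: M ++ [q] := by simp
  have hq : q ∈ p :: M ++ [q] := by simp
  have ha₁ : a₁ ∈ l := by simp [hmem]
  have ha₂ : a₂ ∈ l := by simp [hmem]
  have hb₁ : b₁ ∈ l := by simp [hmem]
  have hb₂ : b₂ ∈ l := by simp [hmem]
  have hpa₁ : G.Adj p a₁ := (hadj _ hp _ ha₁).2 (by simp)
  have hpa₂ : G.Adj p a₂ := (hadj _ hp _ ha₂).2 (by simp)
  have hqb₁ : G.Adj q b₁ := (hadj _ hq _ hb₁).2 (by simp)
  have hqb₂ : G.Adj q b₂ := (hadj _ hq _ hb₂).2 (by simp)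
  have hpq : p ≠ q := by
    simp at hQn
    exact hQn.1.2
  have hqa₁ : ¬ G.Adj q a₁ := by
    rw [hadj _ hq _ ha₁]; simp at hnd; grind
  have hqa₂ : ¬ G.Adj q a₂ := by
    rw [hadj _ hq _ ha₂]; simp at hnd; grind
  have hpb₁ : ¬ G.Adj p b₁ := by
    rw [hadj _ hp _ hb₁]; simp at hnd; grind
  have hpb₂ : ¬ G.Adj p b₂ := by
    rw [hadj _ hp _ hb₂]; simp at hnd; grind
  simp at hnd hch
  have haa : ¬ G.Adj a₁ a₂ := fun haa => by
    obtain ⟨y, -, z, -, -, -, -, hyz⟩ := hc a₁ ha₁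
    have h1 := hyz _ ha₂ haa
    have h2 := hyz _ hb₁ hch.1
    have h3 := hyz _ hb₂ hch.2.2.2.symm
    grind
  have hbb : ¬ G.Adj b₁ b₂ := fun hbb => by
    obtain ⟨y, -, z, -, -, -, -, hyz⟩ := hc b₁ hb₁
    have h1 := hyz _ hb₂ hbb
    have h2 := hyz _ ha₁ hch.1.symm
    have h3 := hyz _ ha₂ hch.2.1
    grind
  have hpl : ∀ x ∈ l, x ≠ p := fun x hx hxp => hdis x hx (hxp ▸ hp)
  have hql : ∀ x ∈ l, x ≠ q := fun x hx hxq => hdis x hx (hxq ▸ hq)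
  have hM : M = [] := by
    have hs : Str G 3 [p, a₂, b₂, a₁] {b₁, q} := by
      refine ⟨?_, ?_, ?_, ?_⟩
      · refine ⟨by simp, by simp; grind, ?_⟩
        simp
        grind [SimpleGraph.Adj.symm]
      · exact (conn_singleton b₁).union_adj (conn_singleton q) rfl rfl hqb₁.symm
      · simp
        grind
      · exact le_ncard_att (a := a₁) (b := a₂) (c := b₂) le_rfl (by simp) (by simp) (by simp)
          (by grind) (by grind) (by grind) ⟨b₁, by simp, hch.1.symm⟩ ⟨b₁, by simp, hch.2.1⟩
          ⟨q, by simp, hqb₂⟩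
    rw [List.eq_nil_iff_forall_not_mem]
    intro x hx
    have h1 := hcov _ _ hs x
    have h2 : ∀ y ∈ l, x ≠ y := by
      rintro y hy rfl
      exact hdis x hy (by simp [hx])
    simp at h1 hQn
    grind
  subst hM
  have hpq' : G.Adj p q := by simpa using hQ
  refine FourVertexMinor.nonempty_iso_k33 (a₁ := a₁) (a₂ := a₂) (a₃ := q) (b₁ := b₁) (b₂ := b₂)
    (b₃ := p) ?_ ?_ ?_ ?_ ?_
  · simp
    grind
  · intro x
    have := hcov' x
    rw [hmem] at this
    simp at this ⊢
    tauto
  · simp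
    grind [SimpleGraph.Adj.symm]
  · have := fun h : G.Adj a₂ a₁ => haa h.symm
    have := fun h : G.Adj a₁ q => hqa₁ h.symm
    have := fun h : G.Adj a₂ q => hqa₂ h.symm
    simp
    grind
  · have := fun h : G.Adj b₂ b₁ => hbb h.symm
    have := fun h : G.Adj b₁ p => hpb₁ h.symm
    have := fun h : G.Adj b₂ p => hpb₂ h.symm
    simp
    grind

/-- The case in which the attached connected set is an induced path. -/
theorem Str.of_path {k : ℕ} {l Q : List α} (h : Str G k l {x | x ∈ Q}) (hk : k ≤ 3)
    (hc : Chordless G l) (hmin : ∀ l' D', Str G k l' D' → l.length ≤ l'.length)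
    (hcov : ∀ l D, Str G k l D → ∀ x, x ∈ l ∨ x ∈ D)
    (h6 : ∀ S : Set α, S.ncard ≤ 5 → ∃ x ∉ S, ∀ y z, ∃ w, G.Adj x w ∧ w ≠ y ∧ w ≠ z)
    (hQ : Q.IsChain G.Adj) (hQn : Q.Nodup) (hQi : Ind G Q) :
    (∃ w, IsCycleGraph (G.induce {u | u ≠ w})) ∨
      Nonempty (G ≃g completeBipartiteGraph (Fin 3) (Fin 3)) := by
  have hcov' := hcov _ _ h
  rcases Q with - | ⟨p, Q⟩
  · obtain ⟨x, hx⟩ := h.2.1.1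
    simp at hx
  rcases Q.eq_nil_or_concat with rfl | ⟨M, q, rfl⟩
  · exact Or.inl ⟨p, h.isCycleGraph hc hcov' (by simp)⟩
  rw [List.concat_eq_append, ← List.cons_append] at *
  have hpM : p ∉ M ++ [q] := by
    rw [List.cons_append, List.nodup_cons] at hQn
    exact hQn.1
  have hqM : q ∉ p :: M := by
    rw [List.nodup_append] at hQn
    exact fun hq => hQn.2.2 q hq q (by simp) rfl
  have hD0 : Conn G {x | x ∈ M ++ [q]} := conn_list (by simp) (List.IsChain.tail hQ)
  have hD1 : Conn G {x | x ∈ p :: M} := conn_list (by simp) (List.isChain_append.1 hQ).1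
  have hs0 : {x | x ∈ M ++ [q]} ⊆ {x | x ∈ p :: M ++ [q]} := fun x hx => List.mem_cons_of_mem _ hx
  have hs1 : {x | x ∈ p :: M} ⊆ {x | x ∈ p :: M ++ [q]} := fun x hx => List.mem_append_left _ hx
  have hp : p ∈ p :: M ++ [q] := by simp
  have hq : q ∈ p :: M ++ [q] := by simp
  obtain ⟨a, ha, hpa, ha0, hpa'⟩ := h.exists_private hcov hD0 hs0 hp hpM
    (fun x hx => List.mem_cons.1 hx)
  obtain ⟨b, hb, hqb, hb1, hqb'⟩ := h.exists_private hcov hD1 hs1 hq hqM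
    (fun x hx => by simpa [or_comm] using (List.mem_append.1 hx).symm)
  have hn0 := h.ncard_att_lt hcov hD0 hs0 hp hpM
  have hn1 := h.ncard_att_lt hcov hD1 hs1 hq hqM
  have hb0 : b ∈ att G l {x | x ∈ M ++ [q]} := ⟨hb, q, by simp, hqb⟩
  have ha1 : a ∈ att G l {x | x ∈ p :: M} := ⟨ha, p, by simp, hpa⟩
  have hatt : att G l {x | x ∈ p :: M ++ [q]} ⊆
      att G l {x | x ∈ p :: M} ∪ att G l {x | x ∈ M ++ [q]} := by
    rintro t ⟨ht, d, hd, hdt⟩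
    rcases List.mem_append.1 hd with hd | hd
    · exact Or.inl ⟨ht, d, hd, hdt⟩
    · exact Or.inr ⟨ht, d, List.mem_append_right _ hd, hdt⟩
  have hab : a ≠ b := by
    rintro rfl
    exact ha0 hb0
  by_cases hM : ∃ d ∈ M, ∃ t ∈ l, G.Adj d t
  · obtain ⟨d, hd, t, ht, hdt⟩ := hM
    have ht0 : t ∈ att G l {x | x ∈ M ++ [q]} := ⟨ht, d, by simp [hd], hdt⟩
    have ht1 : t ∈ att G l {x | x ∈ p :: M} := ⟨ht, d, by simp [hd], hdt⟩
    have hta : t ≠ a := by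
      rintro rfl
      exact ha0 ht0
    have htb : t ≠ b := by
      rintro rfl
      exact hb1 ht1
    have he0 : {b, t} ⊆ att G l {x | x ∈ M ++ [q]} :=
      Set.insert_subset hb0 (Set.singleton_subset_iff.2 ht0)
    have he1 : {a, t} ⊆ att G l {x | x ∈ p :: M} :=
      Set.insert_subset ha1 (Set.singleton_subset_iff.2 ht1)
    have hc0 := Set.ncard_le_ncard he0 (att_finite _ _)
    have hc1 := Set.ncard_le_ncard he1 (att_finite _ _)
    rw [Set.ncard_pair htb.symm] at hc0
    rw [Set.ncard_pair hta.symm] at hc1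
    obtain rfl : k = 3 := by omega
    have he0' := Set.eq_of_subset_of_ncard_le he0
      (by rw [Set.ncard_pair htb.symm]; omega) (att_finite _ _)
    have he1' := Set.eq_of_subset_of_ncard_le he1
      (by rw [Set.ncard_pair hta.symm]; omega) (att_finite _ _)
    refine Or.inl ⟨t, h.isCycleGraph_hub hc hcov h6 hQ hQn hQi (p := p) (q := q) (a := a) (b := b)
      rfl List.getLast?_concat ha hb ht hta htb hab (fun x hx => ⟨hpa' x hx, fun hx => hx ▸ hpa⟩)
      (fun x hx => ⟨hqb' x hx, fun hx => hx ▸ hqb⟩) (hatt.trans ?_)⟩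
    rw [← he0', ← he1']
    rintro x ((rfl | rfl) | (rfl | rfl)) <;> simp
  · push Not at hM
    have h4 : 4 ≤ (att G l {x | x ∈ p :: M ++ [q]}).ncard := by
      by_contra! hlt
      obtain ⟨x, hx, hx3⟩ := h6 (att G l {x | x ∈ p :: M ++ [q]} ∪ {p, q}) (by
        have h1 := Set.ncard_union_le (att G l {x | x ∈ p :: M ++ [q]}) {p, q}
        have h2 := Set.ncard_insert_le p {q}
        have := Set.ncard_singleton q
        omega)
      rw [Set.mem_union, not_or] at hx
      suffices ∃ y z, ∀ w, G.Adj x w → w = y ∨ w = z by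
        obtain ⟨y, z, hyz⟩ := this
        obtain ⟨w, hw, hwy, hwz⟩ := hx3 y z
        have := hyz w hw
        tauto
      rcases hcov' x with hxl | hxQ
      · exact hc.nbrs_of_notMem_att hcov' hxl hx.1
      · have hxM : x ∈ M := by
          have h1 : x ∈ p :: M ++ [q] := hxQ
          have h2 := hx.2
          simp at h1 h2
          tauto
        obtain ⟨y, z, hyz⟩ := hQi.nbrs hQn (a := a) (b := b)
          (fun x hx hxa => by rw [hpa' x hx hxa]; simp)
          (fun x hx hxb => by rw [hqb' x hx hxb, List.getLast?_concat]) hxQ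
        exact ⟨y, z, fun w hxw => hyz w (Or.inl ((hcov' w).resolve_left fun hw =>
          hM x hxM w hw hxw)) hxw⟩
    have h5 := Set.ncard_le_ncard hatt ((att_finite _ _).union (att_finite _ _))
    have h7 := Set.ncard_union_le (att G l {x | x ∈ p :: M}) (att G l {x | x ∈ M ++ [q]})
    obtain rfl : k = 3 := by omega
    obtain ⟨a₁, a₂, haa, he1⟩ := Set.ncard_eq_two.1
      (show (att G l {x | x ∈ p :: M}).ncard = 2 by omega)
    obtain ⟨b₁, b₂, hbb, he0⟩ := Set.ncard_eq_two.1
      (show (att G l {x | x ∈ M ++ [q]}).ncard = 2 by omega)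
    have hdisj : ∀ x, ¬ (x ∈ ({a₁, a₂} : Set α) ∧ x ∈ ({b₁, b₂} : Set α)) := by
      rintro x ⟨hx1, hx0⟩
      have h8 : ({a₁, a₂} ∪ {b₁, b₂} : Set α).ncard < 4 := by
        have hfin : ({a₁, a₂} : Set α).Finite := by simp
        have hfin' : ({b₁, b₂} : Set α).Finite := by simp
        have h8 := Set.ncard_union_add_ncard_inter ({a₁, a₂} : Set α) {b₁, b₂}
        have : 0 < ({a₁, a₂} ∩ {b₁, b₂} : Set α).ncard :=
          (Set.ncard_pos (hfin.subset Set.inter_subset_left)).2 ⟨x, hx1, hx0⟩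
        rw [Set.ncard_pair haa, Set.ncard_pair hbb] at h8
        omega
      rw [he1, he0] at h5
      omega
    have hpl : ∀ y ∈ l, G.Adj p y ↔ y = a₁ ∨ y = a₂ := by
      intro y hy
      have : y ∈ att G l {x | x ∈ p :: M} ↔ y ∈ ({a₁, a₂} : Set α) := by rw [he1]
      simp only [Set.mem_insert_iff, Set.mem_singleton_iff] at this
      rw [← this]
      refine ⟨fun h => ⟨hy, p, by simp, h⟩, ?_⟩
      rintro ⟨-, d, hd, hdy⟩
      rcases List.mem_cons.1 hd with rfl | hd
      · exact hdy
      · exact absurd hdy (hM d hd y hy)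
    have hql : ∀ y ∈ l, G.Adj q y ↔ y = b₁ ∨ y = b₂ := by
      intro y hy
      have : y ∈ att G l {x | x ∈ M ++ [q]} ↔ y ∈ ({b₁, b₂} : Set α) := by rw [he0]
      simp only [Set.mem_insert_iff, Set.mem_singleton_iff] at this
      rw [← this]
      refine ⟨fun h => ⟨hy, q, by simp, h⟩, ?_⟩
      rintro ⟨-, d, hd, hdy⟩
      rcases List.mem_append.1 hd with hd | hd
      · exact absurd hdy (hM d hd y hy)
      · rwa [List.mem_singleton.1 hd] at hdy
    have hmem1 : ∀ x ∈ ({a₁, a₂} : Set α), x ∈ l := fun x hx => by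
      rw [← he1] at hx; exact hx.1
    have hmem0 : ∀ x ∈ ({b₁, b₂} : Set α), x ∈ l := fun x hx => by
      rw [← he0] at hx; exact hx.1
    have ha₁ := hmem1 a₁ (by simp)
    have ha₂ := hmem1 a₂ (by simp)
    have hb₁ := hmem0 b₁ (by simp)
    have hb₂ := hmem0 b₂ (by simp)
    have hd1 := hdisj b₁
    have hd2 := hdisj b₂
    simp at hd1 hd2
    obtain ⟨A, B, hcyc, hperm⟩ := h.1.exists_two ha₁ ha₂ haa
    have hqadj : ∃ d ∈ {x | x ∈ M ++ [q]}, G.Adj d p := by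
      rcases M with - | ⟨m, M⟩
      · exact ⟨q, by simp, by simpa using (show G.Adj p q by simpa using hQ).symm⟩
      · simp only [List.cons_append, List.isChain_cons_cons] at hQ
        exact ⟨m, by simp, hQ.1.symm⟩
    have hbadj : ∀ c, c = b₁ ∨ c = b₂ → ∃ d ∈ {x | x ∈ M ++ [q]}, G.Adj d c := fun c hc =>
      ⟨q, by simp, (hql c (hmem0 c (by simpa using hc))).2 hc⟩
    have hone : ∀ {c : α} {A : List α}, c ∈ A → A.length ≤ 1 → A = [c] := by
      intro c A hc hA
      rcases A with - | ⟨x, - | ⟨y, A⟩⟩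
      · simp at hc
      · simpa using (List.mem_singleton.1 hc).symm
      · simp at hA
    have harcA : ∀ c ∈ A, c = b₁ ∨ c = b₂ → A = [c] := by
      intro c hcA hcb
      exact hone hcA <| h.arc_le hmin hperm hcyc ((hpl _ ha₁).2 (by simp))
          ((hpl _ ha₂).2 (by simp)) hD0 hs0
        hp hpM hqadj hcA (hbadj c hcb)
    have harcB : ∀ c ∈ B, c = b₁ ∨ c = b₂ → B = [c] := by
      intro c hcB hcb
      exact hone hcB <| h.arc_le hmin (List.perm_append_comm.trans hperm) hcyc.rotate
          ((hpl _ ha₂).2 (by simp))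
        ((hpl _ ha₁).2 (by simp)) hD0 hs0 hp hpM hqadj hcB (hbadj c hcb)
    have hAB : ∀ c, c = b₁ ∨ c = b₂ → c ∈ A ∨ c ∈ B := by
      intro c hcb
      have := (hperm.mem_iff (a := c)).2 (hmem0 c (by simpa using hcb))
      simp at this
      grind
    have hcases : (A = [b₁] ∧ B = [b₂]) ∨ (A = [b₂] ∧ B = [b₁]) := by
      have h1 := harcA b₁
      have h2 := harcA b₂
      have h3 := harcB b₁
      have h4 := harcB b₂
      have h5 := hAB b₁
      have h6 := hAB b₂
      grind
    have hadj : ∀ x ∈ p :: M ++ [q], ∀ y ∈ l, G.Adj x y ↔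
        (x = p ∧ (y = a₁ ∨ y = a₂)) ∨ (x = q ∧ (y = b₁ ∨ y = b₂)) := by
      intro x hx y hy
      have hpq : p ≠ q := by
        rintro rfl
        simp at hqM
      have hpM' : p ∉ M := fun hp => hpM (by simp [hp])
      have hqM' : q ∉ M := fun hq => hqM (by simp [hq])
      have h1 := hpl y hy
      have h2 := hql y hy
      have h3 := fun hx => hM x hx y hy
      simp at hx
      grind
    right
    rcases hcases with ⟨rfl, rfl⟩ | ⟨rfl, rfl⟩
    · exact h.nonempty_iso_k33 hc hcov hQ hQn hperm hcyc hadj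
    · exact h.nonempty_iso_k33 hc hcov hQ hQn hperm hcyc
        (by simpa only [or_comm (a := _ = b₂)] using hadj)

theorem Ind.of_append {A B C : List α} (h : Ind G (A ++ (B ++ C))) : Ind G B := by
  rintro X u Y v Z rfl huv
  exact h (A ++ X) u Y v (Z ++ C) (by simp) huv

theorem Ind.reverse {l : List α} (h : Ind G l) : Ind G l.reverse := by
  intro A u B v E he huv
  have := h E.reverse v B.reverse u A.reverse (by
    have := congrArg List.reverse he
    simpa using this) huv.symm
  simpa using this

theorem Ind.cross {X Y : List α} (h : Ind G (X ++ Y)) {x y : α} (hx : x ∈ X) (hy : y ∈ Y)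
    (hxy : G.Adj x y) : X.getLast? = some x ∧ Y.head? = some y := by
  obtain ⟨A, B, rfl⟩ := List.append_of_mem hx
  obtain ⟨C, E, rfl⟩ := List.append_of_mem hy
  have := h A x (B ++ C) y E (by simp) hxy
  simp at this
  obtain ⟨rfl, rfl⟩ := this
  simp

theorem Ind.append {X Y : List α} (hX : Ind G X) (hY : Ind G Y) (hXn : X.Nodup) (hYn : Y.Nodup)
    (hc : ∀ x ∈ X, ∀ y ∈ Y, G.Adj x y → X.getLast? = some x ∧ Y.head? = some y) :
    Ind G (X ++ Y) := by
  have hlast : ∀ {A B : List α} {x : α}, (A ++ x :: B).Nodup →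
      (A ++ x :: B).getLast? = some x → B = [] := by
    intro A B x hn hl
    rcases B.eq_nil_or_concat with rfl | ⟨B, b, rfl⟩
    · rfl
    · rw [List.concat_eq_append, ← List.cons_append, ← List.append_assoc,
        List.getLast?_concat] at hl
      obtain rfl : b = x := by simpa using hl
      simp [List.nodup_append] at hn
  intro A u B v E he huv
  rw [List.append_eq_append_iff] at he
  rcases he with ⟨A', rfl, hY'⟩ | ⟨C, rfl, hC⟩
  · exact hY A' u B v E hY' huv
  rcases C with - | ⟨c, C⟩
  · exact hY [] u B v E (by simpa using hC.symm) huv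
  · simp only [List.cons_append, List.cons.injEq] at hC
    obtain ⟨rfl, hC⟩ := hC
    rw [List.append_eq_append_iff] at hC
    rcases hC with ⟨C', rfl, hE⟩ | ⟨B', rfl, rfl⟩
    · rcases C' with - | ⟨c', C'⟩
      · obtain rfl : Y = v :: E := by simpa using hE.symm
        simpa using hlast hXn (hc u (by simp) v (by simp) huv).1
      · simp only [List.cons_append, List.cons.injEq] at hE
        obtain ⟨rfl, rfl⟩ := hE
        exact hX A u B v C' (by simp) huv
    · obtain ⟨h1, h2⟩ := hc u (by simp) v (by simp) huv
      have hCn := hlast hXn h1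
      rcases B' with - | ⟨b, B'⟩
      · simpa using hCn
      · simp at h2
        subst h2
        simp at hYn

theorem Conn.diff_simplicial {D : Set α} (hD : Conn G D) {d e : α} (he : e ∈ D) (hed : e ≠ d)
    (hd : d ∈ D) (hs : ∀ x ∈ D, ∀ y ∈ D, G.Adj d x → G.Adj d y → x = y ∨ G.Adj x y) :
    Conn G (D \ {d}) := by
  refine ⟨⟨e, he, hed⟩, fun A ⟨a, ha, haA⟩ hA => ?_⟩
  by_cases hn : ∃ n ∈ D, n ∈ A ∧ G.Adj d n
  · obtain ⟨n, hnD, hnA, hdn⟩ := hn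
    have := hD.2 (A ∪ {d}) ⟨a, ha.1, Or.inl haA⟩ fun x hx hxA y hy hxy => by
      by_cases hyd : y = d
      · exact Or.inr hyd
      left
      by_cases hxd : x = d
      · subst hxd
        rcases hs n hnD y hy hdn hxy with rfl | hny
        · exact hnA
        · exact hA n ⟨hnD, hdn.ne'⟩ hnA y ⟨hy, hyd⟩ hny
      · exact hA x ⟨hx, hxd⟩ (hxA.resolve_right hxd) y ⟨hy, hyd⟩ hxy
    exact fun x hx => (this hx.1).resolve_right hx.2
  · push Not at hn
    have := hD.2 (A \ {d}) ⟨a, ha.1, haA, ha.2⟩ fun x hx hxA y hy hxy => by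
      have hyd : y ≠ d := by
        rintro rfl
        exact hn x hx hxA.1 hxy.symm
      exact ⟨hA x ⟨hx, hxA.2⟩ hxA.1 y ⟨hy, hyd⟩ hxy, hyd⟩
    exact absurd rfl (this hd).2

/-- Three disjoint induced paths `L 0`, `L 1`, `L 2` ending in `d 0`, `d 1`, `d 2`. -/
def Legs (G : SimpleGraph α) (d : Fin 3 → α) (L : Fin 3 → List α) : Prop :=
  (∀ i, (L i).getLast? = some (d i) ∧ (L i).IsChain G.Adj ∧ (L i).Nodup ∧ Ind G (L i)) ∧
    ∀ i j, i ≠ j → ∀ x ∈ L i, x ∉ L j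

/-- `D` induces a subdivided claw with centre `u` and legs `L`. -/
def Claw (G : SimpleGraph α) (D : Set α) (d : Fin 3 → α) (L : Fin 3 → List α) (u : α) : Prop :=
  Legs G d L ∧ (∀ x, x ∈ D ↔ x = u ∨ ∃ i, x ∈ L i) ∧ (∀ i, u ∉ L i) ∧
    (∀ i j, i ≠ j → ∀ x ∈ L i, ∀ y ∈ L j, ¬ G.Adj x y) ∧
    ∀ i, ∀ x ∈ L i, G.Adj u x → (L i).head? = some x

/-- `D` induces a triangle with disjoint pendant paths `L`. -/
def Net (G : SimpleGraph α) (D : Set α) (d : Fin 3 → α) (L : Fin 3 → List α) : Prop :=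
  Legs G d L ∧ (∀ x, x ∈ D ↔ ∃ i, x ∈ L i) ∧
    ∀ i j, i ≠ j → ∀ x ∈ L i, ∀ y ∈ L j, G.Adj x y ↔
      (L i).head? = some x ∧ (L j).head? = some y

theorem exists_first {p : α → Prop} {l : List α} (h : ∃ x ∈ l, p x) :
    ∃ A x B, l = A ++ x :: B ∧ p x ∧ ∀ a ∈ A, ¬ p a := by
  induction l with
  | nil => simp at h
  | cons a l ih =>
    by_cases ha : p a
    · exact ⟨[], a, l, rfl, ha, by simp⟩
    · obtain ⟨x, hx, hpx⟩ := h
      have hxl : x ∈ l := by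
        rcases List.mem_cons.1 hx with rfl | hx
        · exact absurd hpx ha
        · exact hx
      obtain ⟨A, y, B, rfl, hy, hA⟩ := ih ⟨x, hxl, hpx⟩
      exact ⟨a :: A, y, B, rfl, hy, by simpa using ⟨ha, hA⟩⟩

theorem forall_ne_fin_three {p : Fin 3 → Fin 3 → Prop} (hs : ∀ i j, p i j → p j i) (h01 : p 0 1)
    (h02 : p 0 2) (h12 : p 1 2) : ∀ i j, i ≠ j → p i j := by
  have h10 := hs _ _ h01
  have h20 := hs _ _ h02
  have h21 := hs _ _ h12
  intro i j hij
  fin_cases i <;> fin_cases j <;> simp_all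

/-- A connected set which is minimal subject to containing three given vertices induces a path,
a subdivided claw or a triangle with pendant paths. -/
theorem Conn.exists_legs {D : Set α} (hD : Conn G D) {d : Fin 3 → α} (hd : ∀ i, d i ∈ D)
    (hfull : ∀ D', Conn G D' → D' ⊆ D → (∀ i, d i ∈ D') → D ⊆ D') :
    (∃ Q : List α, Q.IsChain G.Adj ∧ Q.Nodup ∧ Ind G Q ∧ D = {x | x ∈ Q}) ∨
      (∃ L u, Claw G D d L u) ∨ ∃ L, Net G D d L := by
  by_cases hB : ∃ Q : List α, Q.IsChain G.Adj ∧ Q.Nodup ∧ Ind G Q ∧ D = {x | x ∈ Q}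
  · exact Or.inl hB
  right
  have hno : ∀ Q : List α, Q.IsChain G.Adj → Q.Nodup → Ind G Q → (∀ x ∈ Q, x ∈ D) →
      (∀ i, d i ∈ Q) → False := fun Q h1 h2 h3 h4 h5 =>
    hB ⟨Q, h1, h2, h3, Set.Subset.antisymm
      (hfull {x | x ∈ Q} (conn_list (List.ne_nil_of_mem (h5 0)) h1) h4 h5) h4⟩
  obtain ⟨P, hP0, hP1, hPD, hPc, hPn, hPi⟩ := hD.exists_list (hd 0) (hd 1)
  have hd0 : d 0 ∈ P := List.mem_of_mem_head? (hP0 ▸ rfl)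
  have hd1 : d 1 ∈ P := List.mem_of_mem_getLast? (hP1 ▸ rfl)
  have hd2 : d 2 ∉ P := fun hd2 => hno P hPc hPn hPi hPD fun i => by
    fin_cases i <;> assumption
  obtain ⟨R, y, hy, hRh, hRD, hRc, hRn, hRi, hRP, hRadj⟩ :=
    hD.exists_path (hd 2) (Y := {x | x ∈ P}) ⟨d 0, hd 0, hd0⟩
  rcases R.eq_nil_or_concat with rfl | ⟨R, r, rfl⟩
  · obtain rfl : y = d 2 := by simpa using hRh
    exact absurd hy hd2
  rw [List.concat_eq_append] at *
  have hry : G.Adj r y := by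
    rw [List.isChain_append] at hRc
    exact hRc.2.2 r (by simp) y (by simp)
  replace hRc := (List.isChain_append.1 hRc).1
  replace hRn := (List.nodup_append.1 hRn).1
  replace hRi : Ind G (R ++ [r]) := Ind.of_append (A := []) hRi
  replace hRD : ∀ z ∈ R ++ [r], z ∈ D := fun z hz => hRD z (List.mem_append_left _ hz)
  replace hRh : (R ++ [r]).head? = some (d 2) := by
    rw [← hRh]
    cases R <;> rfl
  replace hRadj : ∀ x ∈ R ++ [r], ∀ z ∈ P, G.Adj x z → x = r := by
    intro x hx z hz hxz
    obtain ⟨A, B, hAB⟩ := List.append_of_mem hx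
    obtain rfl := hRadj A x B z hAB (hPD z hz) hz hxz
    exact (List.append_inj' hAB rfl).2 |> fun h => by simpa using h.symm
  have hd2R : d 2 ∈ R ++ [r] := List.mem_of_mem_head? (hRh ▸ rfl)
  have hDmem : ∀ x, x ∈ D ↔ x ∈ P ∨ x ∈ R ++ [r] := by
    have := hfull ({x | x ∈ P} ∪ {x | x ∈ R ++ [r]})
      ((conn_list (List.ne_nil_of_mem hd0) hPc).union_adj
        (conn_list (List.ne_nil_of_mem hd2R) hRc) hy (show r ∈ R ++ [r] by simp) hry.symm)
      (Set.union_subset hPD hRD) (fun i => by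
        fin_cases i
        exacts [Or.inl hd0, Or.inl hd1, Or.inr hd2R])
    exact fun x => ⟨fun hx => this hx, fun hx => hx.elim (hPD x) (hRD x)⟩
  obtain ⟨P₁, u, P₂, rfl, hru, hP₁⟩ := exists_first (p := G.Adj r) ⟨y, hy, hry⟩
  have hR2 : (R ++ [r]).reverse.getLast? = some (d 2) := by rw [List.getLast?_reverse, hRh]
  have hRh' : (R ++ [r]).reverse.head? = some r := by simp
  have hPi₁ : Ind G (P₁ ++ [u]) := Ind.of_append (A := []) (C := P₂) (by simpa using hPi)
  have hPn₁ : (P₁ ++ [u]).Nodup := by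
    have : (P₁ ++ [u] ++ P₂).Nodup := by simpa using hPn
    exact (List.nodup_append.1 this).1
  have hPc₁ : (P₁ ++ [u]).IsChain G.Adj := by
    have : (P₁ ++ [u] ++ P₂).IsChain G.Adj := by simpa using hPc
    exact (List.isChain_append.1 this).1
  have hPi₂ : Ind G (u :: P₂) := Ind.of_append (A := P₁) (C := []) (by simpa using hPi)
  have hPn₂ : (u :: P₂).Nodup := (List.nodup_append.1 hPn).2.1
  have hPc₂ : (u :: P₂).IsChain G.Adj := (List.isChain_append.1 hPc).2.1
  by_cases hP₂ : ∃ v ∈ P₂, G.Adj r v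
  · obtain ⟨M', v, P₃', hM', hrv, hP₃⟩ := exists_first (p := G.Adj r) (l := P₂.reverse) (by simpa)
    obtain rfl : P₂ = P₃'.reverse ++ v :: M'.reverse := by
      rw [← P₂.reverse_reverse, hM']
      simp
    generalize hM : P₃'.reverse = M at *
    replace hP₃ : ∀ a ∈ M'.reverse, ¬ G.Adj r a := by simpa using hP₃
    generalize M'.reverse = P₃ at *
    clear hM'
    right
    have hPi₃ : Ind G (v :: P₃) := Ind.of_append (A := P₁ ++ u :: M) (C := []) (by simpa using hPi)
    have hPn₃ : (v :: P₃).Nodup := by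
      rw [← List.cons_append, List.nodup_append] at hPn₂
      exact hPn₂.2.1
    have hPc₃ : (v :: P₃).IsChain G.Adj := by
      rw [← List.cons_append, List.isChain_append] at hPc₂
      exact hPc₂.2.1
    have h0 : (P₁ ++ [u]).head? = some (d 0) := by
      rw [← hP0]
      cases P₁ <;> rfl
    have h1 : (v :: P₃).getLast? = some (d 1) := by
      have h : P₁ ++ u :: (M ++ v :: P₃) = (P₁ ++ u :: M) ++ (v :: P₃) := by simp
      rw [h, List.getLast?_append] at hP1
      simpa [List.getLast?_cons] using hP1
    obtain rfl : M = [] := by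
      have := hfull ({x | x ∈ P₁ ++ [u]} ∪ {x | x ∈ R ++ [r]} ∪ {x | x ∈ v :: P₃})
        (((conn_list (by simp) hPc₁).union_adj (conn_list (by simp) hRc)
          (show u ∈ P₁ ++ [u] by simp) (show r ∈ R ++ [r] by simp) hru.symm).union_adj
          (conn_list (by simp) hPc₃) (Or.inr (show r ∈ R ++ [r] by simp))
          (show v ∈ v :: P₃ by simp) hrv)
        (fun x hx => by
          rw [hDmem]
          simp at hx ⊢
          tauto) (fun i => by
          fin_cases i
          exacts [Or.inl (Or.inl (List.mem_of_mem_head? (h0 ▸ rfl))),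
            Or.inr (List.mem_of_mem_getLast? (h1 ▸ rfl)), Or.inl (Or.inr hd2R)])
      rw [List.eq_nil_iff_forall_not_mem]
      intro x hx
      have h2 := fun hxR => hRP x hxR (show x ∈ P₁ ++ u :: (M ++ v :: P₃) by simp [hx])
      have h3 := this ((hDmem x).2 (Or.inl (by simp [hx])))
      simp [List.nodup_append] at h2 h3 hPn
      grind
    have huv : G.Adj u v := by simpa using (List.isChain_cons_cons.1 hPc₂).1
    have hcross : ∀ x ∈ R ++ [r], ∀ z ∈ P₁ ++ u :: ([] ++ v :: P₃), G.Adj x z →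
        x = r ∧ (z = u ∨ z = v) := by
      intro x hx z hz hxz
      obtain rfl := hRadj x hx z hz hxz
      refine ⟨rfl, ?_⟩
      simp at hz
      rcases hz with hz | hz | hz | hz
      · exact absurd hxz (hP₁ z hz)
      · exact Or.inl hz
      · exact Or.inr hz
      · exact absurd hxz (hP₃ z hz)
    have hPe : P₁ ++ u :: ([] ++ v :: P₃) = (P₁ ++ [u]) ++ v :: P₃ := by simp
    have hPn' := hPe ▸ hPn
    have hsub₁ : ∀ x ∈ P₁ ++ [u], x ∈ P₁ ++ u :: ([] ++ v :: P₃) :=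
      fun x hx => hPe ▸ List.mem_append_left _ hx
    have hsub₃ : ∀ x ∈ v :: P₃, x ∈ P₁ ++ u :: ([] ++ v :: P₃) :=
      fun x hx => hPe ▸ List.mem_append_right _ hx
    have hu' : (P₁ ++ [u]).reverse.head? = some u := by simp
    refine ⟨![(P₁ ++ [u]).reverse, v :: P₃, (R ++ [r]).reverse], ⟨?_, ?_⟩, ?_, ?_⟩
    · intro i
      fin_cases i
      exacts [⟨(List.getLast?_reverse).trans h0, chain_reverse hPc₁,
        List.nodup_reverse.2 hPn₁, hPi₁.reverse⟩,
        ⟨h1, hPc₃, hPn₃, hPi₃⟩,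
        ⟨hR2, chain_reverse hRc, List.nodup_reverse.2 hRn, hRi.reverse⟩]
    · apply forall_ne_fin_three
      · exact fun i j h x hx hx' => h x hx' hx
      · intro x hx hx'
        exact (List.nodup_append.1 hPn').2.2 x (List.mem_reverse.1 hx) x hx' rfl
      · intro x hx hx'
        exact hRP x (List.mem_reverse.1 hx') (hsub₁ x (List.mem_reverse.1 hx))
      · intro x hx hx'
        exact hRP x (List.mem_reverse.1 hx') (hsub₃ x hx)
    · intro x
      rw [hDmem]
      simp [Fin.exists_fin_succ]
      tauto
    · apply forall_ne_fin_three
      · exact fun i j h x hx y hy => by rw [G.adj_comm, h y hy x hx, and_comm]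
      · intro x hx y hy
        refine ⟨fun hxy => ?_, ?_⟩
        · have := (hPe ▸ hPi).cross (List.mem_reverse.1 hx) hy hxy
          exact ⟨List.head?_reverse.trans this.1, this.2⟩
        · rintro ⟨hxu, hyv⟩
          obtain rfl := Option.some.inj (hu'.symm.trans hxu)
          obtain rfl : v = y := Option.some.inj hyv
          exact huv
      · intro x hx y hy
        refine ⟨fun hxy => ?_, ?_⟩
        · obtain ⟨rfl, rfl | rfl⟩ := hcross y (List.mem_reverse.1 hy) x
            (hsub₁ x (List.mem_reverse.1 hx)) hxy.symm
          · exact ⟨hu', hRh'⟩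
          · exact absurd rfl ((List.nodup_append.1 hPn').2.2 x (List.mem_reverse.1 hx) x (by simp))
        · rintro ⟨hxu, hyv⟩
          obtain rfl := Option.some.inj (hu'.symm.trans hxu)
          obtain rfl := Option.some.inj (hRh'.symm.trans hyv)
          exact hru.symm
      · intro x hx y hy
        refine ⟨fun hxy => ?_, ?_⟩
        · obtain ⟨rfl, rfl | rfl⟩ := hcross y (List.mem_reverse.1 hy) x (hsub₃ x hx) hxy.symm
          · exact absurd rfl ((List.nodup_append.1 hPn').2.2 x (by simp) x hx)
          · exact ⟨rfl, hRh'⟩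
        · rintro ⟨hxu, hyv⟩
          obtain rfl : v = x := Option.some.inj hxu
          obtain rfl := Option.some.inj (hRh'.symm.trans hyv)
          exact hrv.symm
  · left
    push Not at hP₂
    have hcross : ∀ x ∈ R ++ [r], ∀ z ∈ P₁ ++ u :: P₂, G.Adj x z → x = r ∧ z = u := by
      intro x hx z hz hxz
      obtain rfl := hRadj x hx z hz hxz
      refine ⟨rfl, ?_⟩
      simp at hz
      rcases hz with hz | hz | hz
      · exact absurd hxz (hP₁ z hz)
      · exact hz
      · exact absurd hxz (hP₂ z hz)
    have hpath : ∀ X : List α, X.IsChain G.Adj → X.Nodup → Ind G X →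
        (∀ x, x ∈ X ↔ x ∈ P₁ ++ u :: P₂) → X.getLast? = some u → False := by
      intro X hX hXn hXi hXP hXu
      refine hno (X ++ (R ++ [r]).reverse) ?_ ?_ ?_ ?_ ?_
      · rw [List.isChain_append]
        refine ⟨hX, chain_reverse hRc, ?_⟩
        rw [hXu, hRh']
        simpa using hru.symm
      · rw [List.nodup_append]
        refine ⟨hXn, List.nodup_reverse.2 hRn, ?_⟩
        rintro x hx _ hxR rfl
        exact hRP x (List.mem_reverse.1 hxR) ((hXP x).1 hx)
      · refine hXi.append hRi.reverse hXn (List.nodup_reverse.2 hRn) fun x hx z hz hxz => ?_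
        obtain ⟨rfl, rfl⟩ := hcross z (List.mem_reverse.1 hz) x ((hXP x).1 hx) hxz.symm
        exact ⟨hXu, hRh'⟩
      · intro x hx
        rw [hDmem, ← hXP]
        exact (List.mem_append.1 hx).imp_right List.mem_reverse.1
      · intro i
        rw [List.mem_append, hXP, List.mem_reverse, ← hDmem]
        exact hd i
    have hP₁' : P₁ ≠ [] := by
      rintro rfl
      exact hpath (u :: P₂).reverse (chain_reverse hPc) (List.nodup_reverse.2 hPn) hPi.reverse
        (fun x => List.mem_reverse) (by simp)
    have hP₂' : P₂ ≠ [] := by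
      rintro rfl
      exact hpath _ hPc hPn hPi (by simp) (by simp)
    have hPe : P₁ ++ u :: P₂ = (P₁ ++ [u]) ++ P₂ := by simp
    have hPi' : Ind G ((P₁ ++ [u]) ++ P₂) := hPe ▸ hPi
    have hPn' := List.nodup_append.1 hPn
    have hsub₁ : ∀ x ∈ P₁, x ∈ P₁ ++ u :: P₂ := fun x hx => List.mem_append_left _ hx
    have hsub₂ : ∀ x ∈ P₂, x ∈ P₁ ++ u :: P₂ := fun x hx => hPe ▸ List.mem_append_right _ hx
    have huP₁ : ∀ x ∈ P₁, x ≠ u := fun x hx => hPn'.2.2 x hx u (by simp)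
    have huP₂ : ∀ x ∈ P₂, x ≠ u := by
      rintro x hx rfl
      exact (List.nodup_cons.1 hPn₂).1 hx
    have h0 : P₁.head? = some (d 0) := by
      rw [← hP0]
      cases P₁
      · simp at hP₁'
      · rfl
    have h1 : P₂.getLast? = some (d 1) := by
      rw [← hP1, hPe, List.getLast?_append, List.getLast?_eq_some_getLast hP₂']
      rfl
    refine ⟨![P₁.reverse, P₂, (R ++ [r]).reverse], u, ⟨?_, ?_⟩, ?_, ?_, ?_, ?_⟩
    · intro i
      fin_cases i
      exacts [⟨(List.getLast?_reverse).trans h0, chain_reverse (List.isChain_append.1 hPc).1,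
        List.nodup_reverse.2 hPn'.1, (Ind.of_append (A := []) hPi).reverse⟩,
        ⟨h1, hPc₂.tail, (List.nodup_cons.1 hPn₂).2,
          Ind.of_append (A := P₁ ++ [u]) (C := []) (by simpa using hPi)⟩,
        ⟨hR2, chain_reverse hRc, List.nodup_reverse.2 hRn, hRi.reverse⟩]
    · apply forall_ne_fin_three
      · exact fun i j h x hx hx' => h x hx' hx
      · intro x hx hx'
        exact hPn'.2.2 x (List.mem_reverse.1 hx) x (List.mem_cons_of_mem _ hx') rfl
      · intro x hx hx'
        exact hRP x (List.mem_reverse.1 hx') (hsub₁ x (List.mem_reverse.1 hx))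
      · intro x hx hx'
        exact hRP x (List.mem_reverse.1 hx') (hsub₂ x hx)
    · intro x
      rw [hDmem]
      simp [Fin.exists_fin_succ]
      tauto
    · intro i hi
      fin_cases i
      · exact huP₁ u (List.mem_reverse.1 hi) rfl
      · exact huP₂ u hi rfl
      · exact hRP u (List.mem_reverse.1 hi) (by simp)
    · apply forall_ne_fin_three
      · exact fun i j h x hx y hy hxy => h y hy x hx hxy.symm
      · intro x hx y hy hxy
        have := (hPi.cross (List.mem_reverse.1 hx) (List.mem_cons_of_mem _ hy) hxy).2
        exact huP₂ y hy (Option.some.inj this).symm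
      · intro x hx y hy hxy
        have hx' := List.mem_reverse.1 hx
        exact huP₁ x hx' (hcross y (List.mem_reverse.1 hy) x (hsub₁ x hx') hxy.symm).2
      · intro x hx y hy hxy
        exact huP₂ x hx (hcross y (List.mem_reverse.1 hy) x (hsub₂ x hx) hxy.symm).2
    · intro i x hx hux
      fin_cases i
      · exact List.head?_reverse.trans (hPi.cross (List.mem_reverse.1 hx) (by simp) hux.symm).1
      · exact (hPi'.cross (by simp) hx hux).2
      · obtain ⟨rfl, -⟩ := hcross x (List.mem_reverse.1 hx) u (by simp) hux.symm
        exact hRh'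

theorem exists_walk {l : List α} {a b : α} (ha : l.head? = some a) (hb : l.getLast? = some b)
    (hl : l.IsChain G.Adj) : ∃ p : G.Walk a b, p.support = l := by
  induction l generalizing a with
  | nil => simp at ha
  | cons x l ih =>
    obtain rfl : x = a := by simpa using ha
    rcases l with - | ⟨y, l⟩
    · obtain rfl : x = b := by simpa using hb
      exact ⟨.nil, rfl⟩
    · rw [List.isChain_cons_cons] at hl
      obtain ⟨p, hp⟩ := ih (a := y) rfl (by simpa using hb) hl.2
      exact ⟨.cons hl.1 p, by simp [hp]⟩

theorem Str.eq_of_subset {k : ℕ} {l : List α} {D D' : Set α} (h : Str G k l D)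
    (hcov : ∀ l D, Str G k l D → ∀ x, x ∈ l ∨ x ∈ D) (hD' : Conn G D') (hsub : D' ⊆ D)
    (hk : k ≤ (att G l D').ncard) : D = D' :=
  Set.Subset.antisymm (fun x hx => (hcov l D' ⟨h.1, hD', fun y hy hyD => h.2.2.1 y hy (hsub hyD),
    hk⟩ x).resolve_left fun hxl => h.2.2.1 x hxl hx) hsub

theorem Str.of_two {l : List α} {D : Set α} (h : Str G 2 l D)
    (hc : Chordless G l) (hmin : ∀ l' D', Str G 2 l' D' → l.length ≤ l'.length)
    (hcov : ∀ l D, Str G 2 l D → ∀ x, x ∈ l ∨ x ∈ D)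
    (h6 : ∀ S : Set α, S.ncard ≤ 5 → ∃ x ∉ S, ∀ y z, ∃ w, G.Adj x w ∧ w ≠ y ∧ w ≠ z) :
    (∃ w, IsCycleGraph (G.induce {u | u ≠ w})) ∨
      Nonempty (G ≃g completeBipartiteGraph (Fin 3) (Fin 3)) := by
  obtain ⟨a, ha, b, hb, c, -, hab, -, -, ⟨d, hd, hda⟩, hb', -⟩ :=
    h.exists_triple (by norm_num) (by norm_num)
  obtain ⟨e, he, heb⟩ := hb' le_rfl
  obtain ⟨Q, hQd, hQe, hQD, hQ, hQn, hQi⟩ := h.2.1.exists_list hd he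
  have hdQ : d ∈ Q := List.mem_of_mem_head? (hQd ▸ rfl)
  have heQ : e ∈ Q := List.mem_of_mem_getLast? (hQe ▸ rfl)
  obtain rfl := h.eq_of_subset hcov (conn_list (List.ne_nil_of_mem hdQ) hQ) hQD (by
    rw [← Set.ncard_pair hab]
    refine Set.ncard_le_ncard (Set.insert_subset ⟨ha, d, hdQ, hda⟩
      (Set.singleton_subset_iff.2 ⟨hb, e, heQ, heb⟩)) (att_finite _ _))
  exact h.of_path (by norm_num) hc hmin hcov h6 hQ hQn hQi

/-- Three vertices of a minimal attached set whose removal does not disconnect it have private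
neighbours on the cycle. -/
theorem Str.exists_three_private {l : List α} {D : Set α} (h : Str G 3 l D)
    (hcov : ∀ l D, Str G 3 l D → ∀ x, x ∈ l ∨ x ∈ D) {d : Fin 3 → α} (hd : ∀ i, d i ∈ D)
    (hdi : Function.Injective d) (hconn : ∀ i, Conn G (D \ {d i})) :
    ∃ t : Fin 3 → α, Function.Injective t ∧ (∀ i, t i ∈ l) ∧
      (∀ y ∈ att G l D, ∃ i, y = t i) ∧ ∀ i, ∀ x ∈ D, G.Adj x (t i) ↔ x = d i := by
  have hpriv : ∀ i, ∃ t ∈ l, G.Adj (d i) t ∧ t ∉ att G l (D \ {d i}) ∧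
      ∀ x ∈ D, G.Adj x t → x = d i := fun i =>
    h.exists_private hcov (hconn i) Set.sdiff_subset (hd i) (fun h => h.2 rfl) fun x hx => by
      by_cases hxd : x = d i
      · exact Or.inl hxd
      · exact Or.inr ⟨hx, hxd⟩
  choose t htl hdt _ htd using hpriv
  have hti : Function.Injective t := fun i j hij => hdi (htd j _ (hd i) (hij ▸ hdt i))
  have hatt : ∀ i j k, i ≠ j → i ≠ k → j ≠ k → ∀ y ∈ att G l (D \ {d i}), y = t j ∨ y = t k := by
    intro i j k hij hik hjk y hy
    have h1 := h.ncard_att_lt hcov (hconn i) Set.sdiff_subset (hd i) (fun h => h.2 rfl)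
    have h2 : ({t j, t k} : Set α) ⊆ att G l (D \ {d i}) :=
      Set.insert_subset ⟨htl j, d j, ⟨hd j, fun h => hij (hdi h).symm⟩, hdt j⟩
        (Set.singleton_subset_iff.2 ⟨htl k, d k, ⟨hd k, fun h => hik (hdi h).symm⟩, hdt k⟩)
    have h3 := Set.eq_of_subset_of_ncard_le h2
      (by rw [Set.ncard_pair (fun h => hjk (hti h))]; omega) (att_finite _ _)
    rw [← h3] at hy
    exact hy
  refine ⟨t, hti, htl, ?_, fun i x hx => ⟨htd i x hx, fun hx => hx ▸ hdt i⟩⟩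
  rintro y ⟨hy, x, hx, hxy⟩
  by_cases hx0 : x = d 0
  · rcases hatt 1 0 2 (by decide) (by decide) (by decide) y
      ⟨hy, x, ⟨hx, fun hx1 => absurd (hdi (hx0.symm.trans hx1)) (by decide)⟩, hxy⟩ with h | h
    exacts [⟨_, h⟩, ⟨_, h⟩]
  · rcases hatt 0 1 2 (by decide) (by decide) (by decide) y ⟨hy, x, ⟨hx, hx0⟩, hxy⟩ with h | h
    exacts [⟨_, h⟩, ⟨_, h⟩]

theorem Legs.exists_eq {d : Fin 3 → α} {L : Fin 3 → List α} (h : Legs G d L) (i : Fin 3) :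
    ∃ X, L i = X ++ [d i] ∧ (∀ x ∈ X, G.Adj (d i) x → X.getLast? = some x) ∧
      ((L i).head? = some (d i) → X = []) := by
  obtain ⟨hl, -, hn, hi⟩ := h.1 i
  generalize L i = l at *
  rcases l.eq_nil_or_concat with rfl | ⟨X, y, rfl⟩
  · simp at hl
  rw [List.concat_eq_append] at *
  obtain rfl : y = d i := by simpa using hl
  refine ⟨X, rfl, fun x hx hdx => (hi.cross hx (by simp) hdx.symm).1, fun hh => ?_⟩
  rcases X with - | ⟨x, X⟩
  · rfl
  · obtain rfl : x = d i := by simpa using hh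
    simp at hn

theorem Legs.mem {d : Fin 3 → α} {L : Fin 3 → List α} (h : Legs G d L) (i : Fin 3) : d i ∈ L i :=
  List.mem_of_mem_getLast? ((h.1 i).1 ▸ rfl)

theorem Legs.eq {d : Fin 3 → α} {L : Fin 3 → List α} (h : Legs G d L) {i j : Fin 3} {x : α}
    (hi : x ∈ L i) (hj : x ∈ L j) : i = j := by
  by_contra hij
  exact h.2 i j hij x hi hj

theorem Legs.injective {d : Fin 3 → α} {L : Fin 3 → List α} (h : Legs G d L) :
    Function.Injective d := fun i j hij => h.eq (h.mem i) (hij ▸ h.mem j)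

theorem Claw.conn_diff {D : Set α} {d : Fin 3 → α} {L : Fin 3 → List α} {u : α}
    (h : Claw G D d L u) (hD : Conn G D) (i : Fin 3) : Conn G (D \ {d i}) := by
  obtain ⟨hL, hmem, hu, hno, hhead⟩ := h
  obtain ⟨X, hX, hXl, hXn⟩ := hL.exists_eq i
  have hnb : ∀ x ∈ D, G.Adj (d i) x → (x = u ∧ X = []) ∨ X.getLast? = some x := by
    intro x hx hdx
    rcases (hmem x).1 hx with rfl | ⟨j, hj⟩
    · exact Or.inl ⟨rfl, hXn (hhead i _ (hL.mem i) hdx.symm)⟩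
    · by_cases hij : i = j
      · subst hij
        rw [hX] at hj
        rcases List.mem_append.1 hj with hj | hj
        · exact Or.inr (hXl x hj hdx)
        · exact absurd (List.mem_singleton.1 hj) hdx.ne'
      · exact absurd hdx (hno i j hij _ (hL.mem i) x hj)
  refine hD.diff_simplicial (e := u) ((hmem u).2 (Or.inl rfl)) ?_
    ((hmem _).2 (Or.inr ⟨i, hL.mem i⟩)) fun x hx y hy hdx hdy => Or.inl ?_
  · rintro rfl
    exact hu i (hL.mem i)
  · rcases hnb x hx hdx with ⟨rfl, hX⟩ | h1 <;> rcases hnb y hy hdy with ⟨rfl, hX'⟩ | h2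
    · rfl
    · simp [hX] at h2
    · simp [hX'] at h1
    · exact Option.some.inj (h1.symm.trans h2)

theorem Net.conn_diff {D : Set α} {d : Fin 3 → α} {L : Fin 3 → List α}
    (h : Net G D d L) (hD : Conn G D) (i : Fin 3) : Conn G (D \ {d i}) := by
  obtain ⟨hL, hmem, hadj⟩ := h
  obtain ⟨X, hX, hXl, hXn⟩ := hL.exists_eq i
  have hnb : ∀ x ∈ D, G.Adj (d i) x →
      (X = [] ∧ ∃ j, j ≠ i ∧ x ∈ L j ∧ (L j).head? = some x) ∨ X.getLast? = some x := by
    intro x hx hdx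
    obtain ⟨j, hj⟩ := (hmem x).1 hx
    by_cases hij : i = j
    · subst hij
      rw [hX] at hj
      rcases List.mem_append.1 hj with hj | hj
      · exact Or.inr (hXl x hj hdx)
      · exact absurd (List.mem_singleton.1 hj) hdx.ne'
    · obtain ⟨h1, h2⟩ := (hadj i j hij _ (hL.mem i) x hj).1 hdx
      exact Or.inl ⟨hXn h1, j, fun h => hij h.symm, hj, h2⟩
  have hi : i + 1 ≠ i := by
    fin_cases i <;> decide
  refine hD.diff_simplicial (e := d (i + 1)) ((hmem _).2 ⟨_, hL.mem _⟩)
    (fun h => hi (hL.injective h)) ((hmem _).2 ⟨i, hL.mem i⟩) fun x hx y hy hdx hdy => ?_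
  rcases hnb x hx hdx with ⟨hX, j, hj, hxj, hxh⟩ | h1 <;>
    rcases hnb y hy hdy with ⟨hX', k, hk, hyk, hyh⟩ | h2
  · by_cases hjk : j = k
    · subst hjk
      exact Or.inl (Option.some.inj (hxh.symm.trans hyh))
    · exact Or.inr ((hadj j k hjk x hxj y hyk).2 ⟨hxh, hyh⟩)
  · simp [hX] at h2
  · simp [hX'] at h1
  · exact Or.inl (Option.some.inj (h1.symm.trans h2))

theorem Str.not_claw {l : List α} {D : Set α} (h : Str G 3 l D) (hc : Chordless G l)
    (hcov : ∀ l D, Str G 3 l D → ∀ x, x ∈ l ∨ x ∈ D)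
    (h6 : ∀ S : Set α, S.ncard ≤ 5 → ∃ x ∉ S, ∀ y z, ∃ w, G.Adj x w ∧ w ≠ y ∧ w ≠ z)
    {d : Fin 3 → α} {L : Fin 3 → List α} {u : α} : ¬ Claw G D d L u := by
  intro hC
  have hcov' := hcov _ _ h
  have hconn := hC.conn_diff h.2.1
  obtain ⟨hL, hmem, hu, hno, hhead⟩ := hC
  obtain ⟨t, -, htl, hatt, htd⟩ := h.exists_three_private hcov
    (fun i => (hmem _).2 (Or.inr ⟨i, hL.mem i⟩)) hL.injective hconn
  obtain ⟨x, hx, hx3⟩ := h6 {u, t 0, t 1, t 2} (by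
    have := Set.ncard_insert_le u {t 0, t 1, t 2}
    have := Set.ncard_insert_le (t 0) {t 1, t 2}
    have := Set.ncard_insert_le (t 1) {t 2}
    have := Set.ncard_singleton (t 2)
    omega)
  suffices ∃ y z, ∀ w, G.Adj x w → w = y ∨ w = z by
    obtain ⟨y, z, hyz⟩ := this
    obtain ⟨w, hw, hwy, hwz⟩ := hx3 y z
    have := hyz w hw
    tauto
  rcases hcov' x with hxl | hxD
  · refine hc.nbrs_of_notMem_att hcov' hxl fun hxa => ?_
    obtain ⟨i, rfl⟩ := hatt x hxa
    fin_cases i <;> simp at hx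
  · obtain ⟨i, hi⟩ := ((hmem x).1 hxD).resolve_left fun hxu => hx (by simp [hxu])
    obtain ⟨y, z, hyz⟩ := (hL.1 i).2.2.2.nbrs (hL.1 i).2.2.1 (a := u) (b := t i)
      (fun y hy hyu => hhead i y hy hyu.symm)
      (fun y hy hyt => by rw [(htd i y ((hmem y).2 (Or.inr ⟨i, hy⟩))).1 hyt, (hL.1 i).1]) hi
    refine ⟨y, z, fun w hxw => hyz w ?_ hxw⟩
    rcases hcov' w with hwl | hwD
    · obtain ⟨j, rfl⟩ := hatt w ⟨hwl, x, hxD, hxw⟩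
      obtain rfl := (htd j x hxD).1 hxw
      obtain rfl := hL.eq hi (hL.mem j)
      exact Or.inr (Or.inr rfl)
    · rcases (hmem w).1 hwD with hwu | ⟨j, hj⟩
      · exact Or.inr (Or.inl hwu)
      · by_cases hij : i = j
        · subst hij
          exact Or.inl hj
        · exact absurd hxw (hno i j hij x hi w hj)

theorem Conn.union_list {S : Set α} (hS : Conn G S) {T : List α} (hT : T.IsChain G.Adj)
    (hTS : ∀ x, T.getLast? = some x → ∃ y ∈ S, G.Adj y x) : Conn G (S ∪ {x | x ∈ T}) := by
  rcases T.eq_nil_or_concat with rfl | ⟨T, x, rfl⟩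
  · simpa using hS
  · obtain ⟨y, hy, hyx⟩ := hTS x (by simp)
    exact hS.union_adj (conn_list (by simp) hT) hy (by simp) hyx

theorem Cyc.adj_of_length_le_three {l : List α} (h : Cyc G l) (hl : l.length ≤ 3) {a b c : α}
    (ha : a ∈ l) (hb : b ∈ l) (hc : c ∈ l) (hab : a ≠ b) (hac : a ≠ c) (hbc : b ≠ c) :
    G.Adj a b ∧ G.Adj a c ∧ G.Adj b c ∧ ∀ x ∈ l, x = a ∨ x = b ∨ x = c := by
  obtain ⟨A, B, C, hcyc, hperm⟩ := h.exists_three ha hb hc hab hac hbc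
  have := hperm.length_eq
  simp at this
  obtain rfl : A = [] := List.length_eq_zero_iff.1 (by omega)
  obtain rfl : B = [] := List.length_eq_zero_iff.1 (by omega)
  obtain rfl : C = [] := List.length_eq_zero_iff.1 (by omega)
  have hch := hcyc.2.2
  simp at hch
  refine ⟨hch.1, hch.2.2.symm, hch.2.1, fun x hx => ?_⟩
  simpa using hperm.mem_iff.2 hx

theorem Str.twoTrianglesThreePaths {l : List α} {D : Set α} (h : Str G 3 l D)
    (hmin : ∀ l' D', Str G 3 l' D' → l.length ≤ l'.length)
    (hcov : ∀ l D, Str G 3 l D → ∀ x, x ∈ l ∨ x ∈ D)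
    {d : Fin 3 → α} {L : Fin 3 → List α} (hN : Net G D d L) : TwoTrianglesThreePaths G := by
  have hcov' := hcov _ _ h
  have hdis := h.2.2.1
  have hconn := hN.conn_diff h.2.1
  obtain ⟨hL, hmem, hadj⟩ := hN
  obtain ⟨t, hti, htl, hatt, htd⟩ := h.exists_three_private hcov
    (fun i => (hmem _).2 ⟨i, hL.mem i⟩) hL.injective hconn
  have hLD : ∀ i, ∀ x ∈ L i, x ∈ D := fun i x hx => (hmem x).2 ⟨i, hx⟩
  have hdt : ∀ i, G.Adj (d i) (t i) := fun i => (htd i _ (hLD i _ (hL.mem i))).2 rfl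
  have hcons : ∀ i, ∃ x T, L i = x :: T := fun i => List.exists_cons_of_ne_nil
    (List.ne_nil_of_mem (hL.mem i))
  choose x T hxT using hcons
  have hx : ∀ i, (L i).head? = some (x i) := fun i => by simp [hxT]
  have hxL : ∀ i, x i ∈ L i := fun i => by simp [hxT]
  have hTL : ∀ i, ∀ y ∈ T i, y ∈ L i := fun i y hy => by simp [hxT, hy]
  have hxadj : ∀ i j, i ≠ j → G.Adj (x i) (x j) := fun i j hij =>
    (hadj i j hij _ (hxL i) _ (hxL j)).2 ⟨hx i, hx j⟩
  have hxne : ∀ i j, i ≠ j → x i ≠ x j := fun i j hij => (hxadj i j hij).ne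
  have hlen : l.length ≤ 3 := by
    refine hmin [x 0, x 1, x 2] ({y | y ∈ l} ∪ {y | y ∈ T 0} ∪ {y | y ∈ T 1} ∪ {y | y ∈ T 2})
      ⟨⟨by simp, ?_, ?_⟩, ?_, ?_, ?_⟩
    · simp [hxne]
    · simp [hxadj]
    · have hlc : Conn G {y | y ∈ l} := conn_list h.1.ne_nil h.1.chain
      have hTc : ∀ i, (T i).IsChain G.Adj := fun i => by
        have := (hL.1 i).2.1
        rw [hxT] at this
        exact this.tail
      have hTl : ∀ i, ∀ y, (T i).getLast? = some y → ∃ z ∈ l, G.Adj z y := fun i y hy => by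
        have := (hL.1 i).1
        rw [hxT, List.getLast?_cons, hy] at this
        obtain rfl : y = d i := by simpa using this
        exact ⟨t i, htl i, (hdt i).symm⟩
      refine ((hlc.union_list (hTc 0) (hTl 0)).union_list (hTc 1) fun y hy => ?_).union_list
        (hTc 2) fun y hy => ?_
      · obtain ⟨z, hz, hzy⟩ := hTl 1 y hy
        exact ⟨z, Or.inl hz, hzy⟩
      · obtain ⟨z, hz, hzy⟩ := hTl 2 y hy
        exact ⟨z, Or.inl (Or.inl hz), hzy⟩
    · have key : ∀ i, x i ∉ l ∧ ∀ j, x i ∉ T j := fun i =>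
        ⟨fun hxl => hdis _ hxl (hLD i _ (hxL i)), fun j hxT' => by
          obtain rfl := hL.eq (hxL i) (hTL j _ hxT')
          have := (hL.1 i).2.2.1
          rw [hxT, List.nodup_cons] at this
          exact this.1 hxT'⟩
      simp [key]
    · have key : ∀ i, ∃ y, (y ∈ l ∨ y ∈ T i) ∧ G.Adj y (x i) := by
        intro i
        have h1 := (hL.1 i).1
        have h2 := (hL.1 i).2.1
        rw [hxT] at h1 h2
        generalize T i = T at *
        rcases T with - | ⟨y, T⟩
        · obtain h1 : x i = d i := by simpa using h1
          exact ⟨t i, Or.inl (htl i), h1 ▸ (hdt i).symm⟩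
        · exact ⟨y, Or.inr (by simp), (List.isChain_cons_cons.1 h2).1.symm⟩
      refine le_ncard_att (a := x 0) (b := x 1) (c := x 2) le_rfl (by simp) (by simp) (by simp)
        (hxne _ _ (by decide)) (hxne _ _ (by decide)) (hxne _ _ (by decide)) ?_ ?_ ?_
      · obtain ⟨y, hy, hyx⟩ := key 0
        exact ⟨y, by simp; tauto, hyx⟩
      · obtain ⟨y, hy, hyx⟩ := key 1
        exact ⟨y, by simp; tauto, hyx⟩
      · obtain ⟨y, hy, hyx⟩ := key 2
        exact ⟨y, by simp; tauto, hyx⟩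
  obtain ⟨h01, h02, h12, hlt⟩ := h.1.adj_of_length_le_three hlen (htl 0) (htl 1) (htl 2)
    (fun h => absurd (hti h) (by decide)) (fun h => absurd (hti h) (by decide))
    (fun h => absurd (hti h) (by decide))
  have hlt' : ∀ y ∈ l, ∃ i, y = t i := fun y hy => by
    rcases hlt y hy with h | h | h
    exacts [⟨_, h⟩, ⟨_, h⟩, ⟨_, h⟩]
  have htadj : ∀ i j, i ≠ j → G.Adj (t i) (t j) :=
    forall_ne_fin_three (fun i j h => h.symm) h01 h02 h12
  have hP : ∀ i, ∃ p : G.Walk (x i) (t i), p.support = L i ++ [t i] := fun i =>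
    exists_walk (by simp [hxT]) (by simp) (by
      rw [List.isChain_append]
      refine ⟨(hL.1 i).2.1, by simp, ?_⟩
      rw [(hL.1 i).1]
      simpa using hdt i)
  choose P hP using hP
  have hPm : ∀ i z, z ∈ (P i).support ↔ z ∈ L i ∨ z = t i := fun i z => by simp [hP]
  have htL : ∀ i j, t i ∉ L j := fun i j hij => hdis _ (htl i) (hLD j _ hij)
  have hPd : ∀ i j, i ≠ j → ∀ z, z ∈ (P i).support → z ∉ (P j).support := by
    intro i j hij z hz hz'
    rw [hPm] at hz hz'
    rcases hz with hz | rfl <;> rcases hz' with hz' | hz'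
    · exact hij (hL.eq hz hz')
    · exact htL _ _ (hz' ▸ hz)
    · exact htL _ _ hz'
    · exact hij (hti hz')
  have hedge : ∀ i A y z B, L i ++ [t i] = A ++ y :: z :: B → s(y, z) ∈ (P i).edges := by
    intro i A y z B hAB
    rw [← Walk.infix_support_iff_mem_edges, hP, hAB]
    exact Or.inl ⟨A, B, by simp⟩
  have hPcov : ∀ z, ∃ i, z ∈ (P i).support := fun z => by
    rcases hcov' z with hz | hz
    · obtain ⟨i, rfl⟩ := hlt' z hz
      exact ⟨i, by simp [hPm]⟩
    · obtain ⟨i, hi⟩ := (hmem z).1 hz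
      exact ⟨i, by simp [hPm, hi]⟩
  have hLt : ∀ i, ∀ y ∈ L i, ∀ j, G.Adj y (t j) → s(y, t j) ∈ (P i).edges := by
    intro i y hy j hyt
    obtain rfl := (htd j y (hLD i y hy)).1 hyt
    obtain rfl := hL.eq hy (hL.mem j)
    obtain ⟨X, hX, -⟩ := hL.exists_eq i
    exact hedge i X _ _ [] (by simp [hX])
  have hLL : ∀ i, ∀ y ∈ L i, ∀ z ∈ L i, G.Adj y z → s(y, z) ∈ (P i).edges := by
    have key : ∀ i A y B z, L i = A ++ y :: B → z ∈ B → G.Adj y z → s(y, z) ∈ (P i).edges := by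
      intro i A y B z hAB hz hyz
      obtain ⟨B, C, rfl⟩ := List.append_of_mem hz
      obtain rfl := (hL.1 i).2.2.2 A y B z C hAB hyz
      exact hedge i A y z (C ++ [t i]) (by simp [hAB])
    intro i y hy z hz hyz
    obtain ⟨A, B, hAB⟩ := List.append_of_mem hy
    rw [hAB] at hz
    rcases List.mem_append.1 hz with hz | hz
    · obtain ⟨A, C, rfl⟩ := List.append_of_mem hz
      rw [Sym2.eq_swap]
      exact key i A z (C ++ y :: B) y (by simp [hAB]) (by simp) hyz.symm
    · exact key i A y B z hAB ((List.mem_cons.1 hz).resolve_left hyz.ne') hyz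
  refine ⟨x, t, hxadj, htadj, fun i j hij => htL j i (hij ▸ hxL i), P, fun i => ?_, hPd, ?_,
    hPcov, ?_⟩
  · rw [Walk.isPath_def, hP, List.nodup_append]
    refine ⟨(hL.1 i).2.2.1, by simp, ?_⟩
    rintro y hy _ hyt rfl
    exact htL i i (List.mem_singleton.1 hyt ▸ hy)
  · intro i j z hz hzj
    by_cases hij : i = j
    · exact hij ▸ hzj
    · refine absurd ?_ (hPd i j hij z hz)
      rcases hzj with rfl | rfl
      · exact (P j).start_mem_support
      · exact (P j).end_mem_support
  · intro z w hzw
    obtain ⟨i, hi⟩ := hPcov z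
    obtain ⟨j, hj⟩ := hPcov w
    rw [hPm] at hi hj
    rcases hi with hi | rfl <;> rcases hj with hj | rfl
    · by_cases hij : i = j
      · subst hij
        exact Or.inr ⟨i, hLL i z hi w hj hzw⟩
      · obtain ⟨h1, h2⟩ := (hadj i j hij z hi w hj).1 hzw
        rw [hx] at h1 h2
        exact Or.inl ⟨i, j, hij, Or.inl ⟨(Option.some.inj h1).symm, (Option.some.inj h2).symm⟩⟩
    · exact Or.inr ⟨i, hLt i z hi j hzw⟩
    · exact Or.inr ⟨j, Sym2.eq_swap ▸ hLt j w hj i hzw.symm⟩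
    · exact Or.inl ⟨i, j, fun hij => hzw.ne (hij ▸ rfl), Or.inr ⟨rfl, rfl⟩⟩

theorem Str.of_three {l : List α} {D : Set α} (h : Str G 3 l D)
    (hc : Chordless G l) (hmin : ∀ l' D', Str G 3 l' D' → l.length ≤ l'.length)
    (hcov : ∀ l D, Str G 3 l D → ∀ x, x ∈ l ∨ x ∈ D)
    (h6 : ∀ S : Set α, S.ncard ≤ 5 → ∃ x ∉ S, ∀ y z, ∃ w, G.Adj x w ∧ w ≠ y ∧ w ≠ z) :
    (∃ w, IsCycleGraph (G.induce {u | u ≠ w})) ∨ TwoTrianglesThreePaths G ∨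
      Nonempty (G ≃g completeBipartiteGraph (Fin 3) (Fin 3)) := by
  obtain ⟨a, ha, b, hb, c, hcl, hab, hac, hbc, ⟨d, hd, hda⟩, hb', hc'⟩ :=
    h.exists_triple (by norm_num) (by norm_num)
  obtain ⟨e, he, heb⟩ := hb' (by norm_num)
  obtain ⟨f, hf, hfc⟩ := hc' le_rfl
  rcases h.2.1.exists_legs (d := ![d, e, f]) (by simp [Fin.forall_fin_succ, hd, he, hf])
    (fun D' hD' hsub hd' => (h.eq_of_subset hcov hD' hsub (le_ncard_att le_rfl ha hb hcl hab hac hbc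
      ⟨d, hd' 0, hda⟩ ⟨e, hd' 1, heb⟩ ⟨f, hd' 2, hfc⟩)).subset) with
    ⟨Q, hQ, hQn, hQi, rfl⟩ | ⟨L, u, hC⟩ | ⟨L, hN⟩
  · rcases h.of_path le_rfl hc hmin hcov h6 hQ hQn hQi with h | h
    exacts [Or.inl h, Or.inr (Or.inr h)]
  · exact absurd hC (h.not_claw hc hcov h6)
  · exact Or.inr (Or.inl (h.twoTrianglesThreePaths hmin hcov hN))

theorem outcome_of_tri {k : ℕ} {H : SimpleGraph (Fin 4)} (hH : Tri k H) (hG : G.Connected)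
    (hm : MinorMinimal G H)
    (h6 : ∀ S : Set α, S.ncard ≤ 5 → ∃ x ∉ S, ∀ y z, ∃ w, G.Adj x w ∧ w ≠ y ∧ w ≠ z) :
    (∃ w, IsCycleGraph (G.induce {u | u ≠ w})) ∨ TwoTrianglesThreePaths G ∨
      Nonempty (G ≃g completeBipartiteGraph (Fin 3) (Fin 3)) := by
  have hcov : ∀ l D, Str G k l D → ∀ x, x ∈ l ∨ x ∈ D := by
    intro l D h x
    by_contra hx
    exact hm.2 x (h.hasMinor hH hx)
  obtain ⟨l, D, h, hc, hmin⟩ := exists_min_str hH.2.1 (exists_str_of_hasMinor hH hG hm.1)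
  obtain rfl | rfl | rfl : k = 1 ∨ k = 2 ∨ k = 3 := by
    have := hH.1
    have := hH.2.1
    omega
  · obtain ⟨t, ht, d, hd, hdt⟩ := (Set.ncard_pos (att_finite _ _)).1 h.2.2.2
    have hD := h.eq_of_subset hcov (conn_singleton d) (Set.singleton_subset_iff.2 hd)
      ((Set.ncard_pos (att_finite _ _)).2 ⟨t, ht, d, rfl, hdt⟩)
    exact Or.inl ⟨d, h.isCycleGraph hc (hcov l D h) hD⟩
  · exact (h.of_two hc hmin hcov h6).imp_right Or.inr
  · exact h.of_three hc hmin hcov h6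

theorem exists_cyc_of_hasMinor {H : SimpleGraph (Fin 4)} (h01 : H.Adj 0 1) (h12 : H.Adj 1 2)
    (h23 : H.Adj 2 3) (h30 : H.Adj 3 0) (hm : HasMinor G H) : ∃ l, Cyc G l ∧ 4 ≤ l.length := by
  obtain ⟨V, hne, hdis, hcon, hadj⟩ := hm
  have hV : ∀ i, Conn G (V i) := fun i => conn_of_connected (hcon i)
  have hdis' : ∀ i j, i ≠ j → ∀ x ∈ V i, x ∉ V j := fun i j hij x hx hx' =>
    Set.disjoint_left.1 (hdis hij) hx hx'
  have glue : ∀ i j, i ≠ j → ∀ a ∈ V i, ∀ d ∈ V j, H.Adj i j → ∃ L : List α,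
      L.head? = some a ∧ L.getLast? = some d ∧ (∀ x ∈ L, x ∈ V i ∨ x ∈ V j) ∧
      L.IsChain G.Adj ∧ L.Nodup ∧ 2 ≤ L.length := by
    intro i j hij a ha d hd h
    obtain ⟨b, hb, c, hc, hbc⟩ := hadj i j h
    obtain ⟨P, hP1, hP2, hPS, hPc, hPn, -⟩ := (hV i).exists_list ha hb
    obtain ⟨Q, hQ1, hQ2, hQS, hQc, hQn, -⟩ := (hV j).exists_list hc hd
    have hPne := List.length_pos_iff.2 (show P ≠ [] by rintro rfl; simp at hP1)
    have hQne := List.length_pos_iff.2 (show Q ≠ [] by rintro rfl; simp at hQ1)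
    refine ⟨P ++ Q, ?_, ?_, ?_, ?_, ?_, ?_⟩
    · rw [List.head?_append, hP1]
      rfl
    · rw [List.getLast?_append, hQ2]
      rfl
    · intro x hx
      exact (List.mem_append.1 hx).imp (hPS x) (hQS x)
    · rw [List.isChain_append]
      refine ⟨hPc, hQc, ?_⟩
      rw [hP2, hQ1]
      simpa using hbc
    · rw [List.nodup_append]
      refine ⟨hPn, hQn, ?_⟩
      rintro x hx y hy rfl
      exact hdis' i j hij x (hPS x hx) (hQS x hy)
    · simp only [List.length_append]
      omega
  obtain ⟨b, hb, c, hc, hbc⟩ := hadj 1 2 h12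
  obtain ⟨d, hd, a, ha, hda⟩ := hadj 3 0 h30
  obtain ⟨P, hP1, hP2, hPS, hPc, hPn, hPl⟩ := glue 0 1 (by decide) a ha b hb h01
  obtain ⟨Q, hQ1, hQ2, hQS, hQc, hQn, hQl⟩ := glue 2 3 (by decide) c hc d hd h23
  refine ⟨P ++ Q, cyc_glue hPc hQc hPn hQn ?_ hP1 hP2 hQ1 hQ2 hbc hda (by omega), ?_⟩
  · intro x hx hxQ
    rcases hPS x hx with h | h <;> rcases hQS x hxQ with h' | h' <;>
      exact hdis' _ _ (by decide) x h h'
  · rw [List.length_append]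
    omega

theorem Cyc.hasMinor {H : SimpleGraph (Fin 4)} (h02 : ¬ H.Adj 0 2) (h13 : ¬ H.Adj 1 3)
    {l : List α} (h : Cyc G l) (hl : 4 ≤ l.length) {x : α} (hx : x ∉ l) :
    HasMinor (G.induce {y | y ≠ x}) H := by
  match l, hl with
  | p :: q :: r :: s :: M, _ =>
    have hc := cyc_split (A := [q, r]) (a := p) (b := s) (B := M) |>.1 h
    obtain ⟨-, hn, h1, h2⟩ := hc
    simp only [List.cons_append, List.nil_append, List.isChain_cons_cons, List.nodup_cons,
      List.mem_cons, not_or, List.isChain_singleton, and_true] at h1 hn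
    obtain ⟨t, ht, htp⟩ : ∃ t ∈ s :: M, G.Adj t p := by
      rw [List.isChain_append] at h2
      refine ⟨(s :: M).getLast (by simp), List.getLast_mem _, ?_⟩
      exact h2.2.2 _ (List.getLast?_eq_some_getLast _) p rfl
    have hsM : (s :: M).IsChain G.Adj := (List.isChain_append.1 h2).1
    simp only [List.mem_cons, not_or] at hx
    refine hasMinor_of_sets ![{p}, {q}, {r}, {y | y ∈ s :: M}] ?_ ?_ ?_ x ?_
    · simp only [Fin.forall_fin_succ]
      simpa [conn_singleton] using conn_list (by simp) hsM
    · simp [Fin.forall_fin_succ]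
      tauto
    · have := htp.symm
      have := h1.2.2
      simp [Fin.forall_fin_succ, h02, h13] at ht ⊢
      rcases ht with rfl | ht
      · tauto
      · tauto
    · simp [Fin.forall_fin_succ]
      tauto

theorem not_minorMinimal_of_square {H : SimpleGraph (Fin 4)} (h01 : H.Adj 0 1) (h12 : H.Adj 1 2)
    (h23 : H.Adj 2 3) (h30 : H.Adj 3 0) (h02 : ¬ H.Adj 0 2) (h13 : ¬ H.Adj 1 3)
    (h6 : ∀ S : Set α, S.ncard ≤ 5 → ∃ x ∉ S, ∀ y z, ∃ w, G.Adj x w ∧ w ≠ y ∧ w ≠ z) :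
    ¬ MinorMinimal G H := by
  classical
  intro hm
  have hcov : ∀ l, Cyc G l → 4 ≤ l.length → ∀ x, x ∈ l := by
    intro l h hl x
    by_contra hx
    exact hm.2 x (h.hasMinor h02 h13 hl hx)
  have hP : ∃ n, ∃ l, Cyc G l ∧ 4 ≤ l.length ∧ l.length = n := by
    obtain ⟨l, h, hl⟩ := exists_cyc_of_hasMinor h01 h12 h23 h30 hm.1
    exact ⟨_, l, h, hl, rfl⟩
  obtain ⟨l, h, hl, hln⟩ := Nat.find_spec hP
  have hmin : ∀ l', Cyc G l' → 4 ≤ l'.length → l.length ≤ l'.length := fun l' h' hl' =>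
    hln ▸ Nat.find_min' hP ⟨l', h', hl', rfl⟩
  have hl6 : 6 ≤ l.length := by
    by_contra hl6
    obtain ⟨x, hx, -⟩ := h6 {x | x ∈ l} (by
      have h1 := List.toFinset_card_le l
      have h2 := Set.ncard_coe_finset l.toFinset
      rw [List.coe_toFinset] at h2
      omega)
    exact hx (hcov l h hl x)
  have hc : Chordless G l := h.chordless fun u A v B hc hp huv => by
    by_contra! hne
    have h1 := hc.chord hne.1 huv
    have h2 := hc.rotate.chord hne.2 huv.symm
    have h3 := hmin _ h1
    have h4 := hmin _ h2
    have h5 := hp.length_eq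
    simp only [List.length_append, List.length_cons, List.length_nil] at h3 h4 h5
    have := List.length_pos_iff.2 hne.1
    have := List.length_pos_iff.2 hne.2
    omega
  obtain ⟨x, -, hx⟩ := h6 ∅ (by simp)
  obtain ⟨y, z, hyz⟩ := hc.nbrs (hcov l h hl x)
  obtain ⟨w, hxw, hwy, hwz⟩ := hx y z
  rcases hyz w (hcov l h hl w) hxw with rfl | rfl
  · exact hwy rfl
  · exact hwz rfl

theorem hasMinor_of_vertices {H : SimpleGraph (Fin 4)} {v : Fin 4 → α}
    (hv : ∀ i j, i < j → v i ≠ v j) (ha : ∀ i j, i < j → H.Adj i j → G.Adj (v i) (v j)) {x : α}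
    (hx : ∀ i, x ≠ v i) : HasMinor (G.induce {y | y ≠ x}) H :=
  hasMinor_of_sets (fun i => {v i}) (fun i => conn_singleton _)
    (by rintro i j hij _ rfl; exact hv i j hij)
    (fun i j hij h => ⟨_, rfl, _, rfl, ha i j hij h⟩) x hx

theorem exists_hasMinor_of_vertices {H : SimpleGraph (Fin 4)}
    (h6 : ∀ S : Set α, S.ncard ≤ 5 → ∃ x ∉ S, ∀ y z, ∃ w, G.Adj x w ∧ w ≠ y ∧ w ≠ z)
    {v : Fin 4 → α} (hv : ∀ i j, i < j → v i ≠ v j)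
    (ha : ∀ i j, i < j → H.Adj i j → G.Adj (v i) (v j)) :
    ∃ x, HasMinor (G.induce {y | y ≠ x}) H := by
  obtain ⟨x, hx, -⟩ := h6 (Set.range v) (by
    have := Set.ncard_image_le (f := v) (Set.toFinite (Set.univ : Set (Fin 4)))
    rw [Set.image_univ, Set.ncard_univ, Nat.card_eq_fintype_card, Fintype.card_fin] at this
    omega)
  exact ⟨x, hasMinor_of_vertices hv ha fun i hi => hx ⟨i, hi.symm⟩⟩

theorem not_minorMinimal_of_star {H : SimpleGraph (Fin 4)} (h12 : ¬ H.Adj 1 2)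
    (h13 : ¬ H.Adj 1 3) (h23 : ¬ H.Adj 2 3)
    (h6 : ∀ S : Set α, S.ncard ≤ 5 → ∃ x ∉ S, ∀ y z, ∃ w, G.Adj x w ∧ w ≠ y ∧ w ≠ z) :
    ¬ MinorMinimal G H := by
  intro hm
  obtain ⟨u, -, hu⟩ := h6 ∅ (by simp)
  obtain ⟨a, ha, -⟩ := hu u u
  obtain ⟨b, hb, hba, -⟩ := hu a a
  obtain ⟨c, hc, hca, hcb⟩ := hu a b
  obtain ⟨x, hx⟩ := exists_hasMinor_of_vertices (H := H) h6 (v := ![u, a, b, c])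
    (by simp [Fin.forall_fin_succ, ha.ne, hb.ne, hc.ne, hba.symm, hca.symm, hcb.symm])
    (by simp [Fin.forall_fin_succ, ha, hb, hc, h12, h13, h23])
  exact hm.2 x hx

theorem not_minorMinimal_of_path {H : SimpleGraph (Fin 4)} (h02 : ¬ H.Adj 0 2)
    (h13 : ¬ H.Adj 1 3) (h03 : ¬ H.Adj 0 3) (hG : G.Connected)
    (h6 : ∀ S : Set α, S.ncard ≤ 5 → ∃ x ∉ S, ∀ y z, ∃ w, G.Adj x w ∧ w ≠ y ∧ w ≠ z) :
    ¬ MinorMinimal G H := by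
  intro hm
  obtain ⟨a, b, c, d, hab, hbc, hcd, hac, had, hbd⟩ : ∃ a b c d, G.Adj a b ∧ G.Adj b c ∧
      G.Adj c d ∧ a ≠ c ∧ a ≠ d ∧ b ≠ d := by
    obtain ⟨u, -, hu⟩ := h6 ∅ (by simp)
    obtain ⟨v, hvu, hv⟩ := h6 {u} (by simp)
    by_cases huv : G.Adj u v
    · obtain ⟨a, ha, hav, -⟩ := hu v v
      obtain ⟨b, hb, hbu, hba⟩ := hv u a
      exact ⟨a, u, v, b, ha.symm, huv, hb, hav, hba.symm, hbu.symm⟩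
    · have hGc : Conn G Set.univ := conn_of_connected ((induceUnivIso G).connected_iff.2 hG)
      obtain ⟨a, -, ha, b, -, hb, hab⟩ := hGc.exists_crossing {w | w = u ∨ G.Adj u w}
        ⟨u, trivial, Or.inl rfl⟩ ⟨v, trivial, fun h => h.elim hvu huv⟩
      simp only [Set.mem_ofPred_eq, not_or] at ha hb
      rcases ha with rfl | ha
      · exact absurd hab hb.2
      · obtain ⟨c, hc, hca, -⟩ := hu a a
        refine ⟨b, a, u, c, hab.symm, ha.symm, hc, hb.1, ?_, hca.symm⟩
        rintro rfl
        exact hb.2 hc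
  obtain ⟨x, hx⟩ := exists_hasMinor_of_vertices (H := H) h6 (v := ![a, b, c, d])
    (by simp [Fin.forall_fin_succ, hab.ne, hbc.ne, hcd.ne, hac, had, hbd])
    (by simp [Fin.forall_fin_succ, hab, hbc, hcd, h02, h13, h03])
  exact hm.2 x hx

theorem hasMinor_comap {γ : Type*} {H : SimpleGraph β} (h : HasMinor G H) {f : γ → β}
    (hf : Function.Injective f) : HasMinor G (H.comap f) := by
  obtain ⟨V, hne, hdis, hcon, hadj⟩ := h
  exact ⟨fun i => V (f i), fun i => hne _, fun i j hij => hdis (hf.ne hij), fun i => hcon _,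
    fun i j hij => hadj _ _ hij⟩

theorem minorMinimal_comap {γ : Type*} {H : SimpleGraph β} (h : MinorMinimal G H) (e : γ ≃ β) :
    MinorMinimal G (H.comap e) := by
  refine ⟨hasMinor_comap h.1 e.injective, fun x hx => h.2 x ?_⟩
  have := hasMinor_comap hx e.symm.injective
  rwa [comap_comap, e.self_comp_symm, comap_id] at this

/-- Every graph on four vertices can be labelled so as to contain a triangle in one of the normal
forms `Tri`, or to be a four-cycle, or to be contained in a four-vertex star or path. -/
theorem exists_labelling (H : SimpleGraph (Fin 4)) : ∃ e : Fin 4 ≃ Fin 4,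
    (∃ k, Tri k (H.comap e)) ∨
    ((H.comap e).Adj 0 1 ∧ (H.comap e).Adj 1 2 ∧ (H.comap e).Adj 2 3 ∧ (H.comap e).Adj 3 0 ∧
      ¬ (H.comap e).Adj 0 2 ∧ ¬ (H.comap e).Adj 1 3) ∨
    (¬ (H.comap e).Adj 1 2 ∧ ¬ (H.comap e).Adj 1 3 ∧ ¬ (H.comap e).Adj 2 3) ∨
    (¬ (H.comap e).Adj 0 2 ∧ ¬ (H.comap e).Adj 1 3 ∧ ¬ (H.comap e).Adj 0 3) := by
  classical
  have key : ∀ p q r s t u : Bool, ∃ a b c d : Fin 4,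
      a ≠ b ∧ a ≠ c ∧ a ≠ d ∧ b ≠ c ∧ b ≠ d ∧ c ≠ d ∧
      let A : Fin 4 → Fin 4 → Bool :=
        ![![false, p, q, r], ![p, false, s, t], ![q, s, false, u], ![r, t, u, false]]
      ((A a b ∧ A a c ∧ A b c ∧ (A b d → A a d) ∧ (A c d → A b d)) ∨
        (A a b ∧ A b c ∧ A c d ∧ A d a ∧ ¬ A a c ∧ ¬ A b d) ∨
        (¬ A b c ∧ ¬ A b d ∧ ¬ A c d) ∨ (¬ A a c ∧ ¬ A b d ∧ ¬ A a d)) := by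
    decide
  obtain ⟨a, b, c, d, hab, hac, had, hbc, hbd, hcd, h⟩ := key (decide (H.Adj 0 1))
    (decide (H.Adj 0 2)) (decide (H.Adj 0 3)) (decide (H.Adj 1 2)) (decide (H.Adj 1 3))
    (decide (H.Adj 2 3))
  extract_lets A at h
  have hA : ∀ i j, A i j = true ↔ H.Adj i j := by
    intro i j
    fin_cases i <;> fin_cases j <;> simp [A, H.adj_comm 1 0, H.adj_comm 2 0,
      H.adj_comm 3 0, H.adj_comm 2 1, H.adj_comm 3 1, H.adj_comm 3 2]
  simp only [hA] at h
  have hinj : Function.Injective ![a, b, c, d] := by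
    intro i j
    fin_cases i <;> fin_cases j <;>
      simp [hab, hac, had, hbc, hbd, hcd, hab.symm, hac.symm, had.symm, hbc.symm, hbd.symm,
        hcd.symm]
  refine ⟨Equiv.ofBijective _ (Finite.injective_iff_bijective.1 hinj), h.imp ?_ id⟩
  rintro ⟨h01, h02, h12, h03, h13⟩
  by_cases h1 : H.Adj b d
  · by_cases h2 : H.Adj c d
    · exact ⟨3, by simp, by simp, h01, h02, h12, fun _ => h03 h1, by simpa using h1,
        by simpa using h2⟩
    · exact ⟨2, by simp, by simp, h01, h02, h12, fun _ => h03 h1, by simpa using h1,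
        by simpa using h2⟩
  · exact ⟨1, by simp, by simp, h01, h02, h12, by simp, by simpa using h1,
      by simpa using fun h2 => h1 (h13 h2)⟩

theorem exists_branch_vertex [Finite α]
    (h : 6 ≤ {u : α | 3 ≤ (G.neighborSet u).ncard}.ncard) (S : Set α) (hS : S.ncard ≤ 5) :
    ∃ x ∉ S, ∀ y z, ∃ w, G.Adj x w ∧ w ≠ y ∧ w ≠ z := by
  obtain ⟨x, hx, hxS⟩ := Set.exists_mem_notMem_of_ncard_lt_ncard (hS.trans_lt h) (Set.toFinite S)
  refine ⟨x, hxS, fun y z => ?_⟩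
  have hyz : ({y, z} : Set α).ncard ≤ 2 := by
    simpa using Set.ncard_insert_le y {z}
  obtain ⟨w, hw, hwyz⟩ := Set.exists_mem_notMem_of_ncard_lt_ncard
    (hyz.trans_lt (show 2 < (G.neighborSet x).ncard from hx)) (Set.toFinite _)
  simp only [Set.mem_insert_iff, Set.mem_singleton_iff, not_or] at hwyz
  exact ⟨w, hw, hwyz⟩

theorem outcome_of_six_branch_vertices (G : SimpleGraph α) [Fintype α] (H : SimpleGraph β)
    [Fintype β] (hcard : Fintype.card β = 4) (hG : G.Connected) (hm : MinorMinimal G H)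
    (h : 6 ≤ {u : α | 3 ≤ (G.neighborSet u).ncard}.ncard) :
    (∃ w, IsCycleGraph (G.induce {u | u ≠ w})) ∨ TwoTrianglesThreePaths G ∨
      Nonempty (G ≃g completeBipartiteGraph (Fin 3) (Fin 3)) := by
  have h6 := exists_branch_vertex h
  have hm' := minorMinimal_comap hm (Fintype.equivFinOfCardEq hcard).symm
  obtain ⟨e, ⟨k, hk⟩ | ⟨h01, h12, h23, h30, h02, h13⟩ | ⟨h12, h13, h23⟩ | ⟨h02, h13, h03⟩⟩ :=
    exists_labelling (H.comap (Fintype.equivFinOfCardEq hcard).symm)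
  · exact outcome_of_tri hk hG (minorMinimal_comap hm' e) h6
  · exact absurd (minorMinimal_comap hm' e) (not_minorMinimal_of_square h01 h12 h23 h30 h02 h13 h6)
  · exact absurd (minorMinimal_comap hm' e) (not_minorMinimal_of_star h12 h13 h23 h6)
  · exact absurd (minorMinimal_comap hm' e) (not_minorMinimal_of_path h02 h13 h03 hG h6)

end FourVertexMinor

end

/-- Classification of connected `H'`-minimal graphs for a graph `H'` on four
vertices: such a graph is a subdivision of `H'`, or has exactly four vertices, or is
a cycle, or is a wheel, or is an induced cycle plus one additional vertex, or
consists of two disjoint triangles joined by three disjoint paths, or has at most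
five vertices of degree at least 3, or is isomorphic to `K_{3,3}`. -/
theorem minimal_graphs_for_four_vertex_minor (G : SimpleGraph α) [Fintype α]
    (H' : SimpleGraph β) [Fintype β] (hcard : Fintype.card β = 4)
    (hconn : G.Connected) (hmin : MinorMinimal G H') :
    IsSubdivision G H' ∨
    Fintype.card α = 4 ∨
    IsCycleGraph G ∨
    IsWheel G ∨
    (∃ w : α, IsCycleGraph (G.induce {u | u ≠ w})) ∨
    TwoTrianglesThreePaths G ∨
    {u : α | 3 ≤ (G.neighborSet u).ncard}.ncard ≤ 5 ∨
    Nonempty (G ≃g completeBipartiteGraph (Fin 3) (Fin 3)) := by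
  by_cases h : {u : α | 3 ≤ (G.neighborSet u).ncard}.ncard ≤ 5
  · tauto
  · have := FourVertexMinor.outcome_of_six_branch_vertices G H' hcard hconn hmin (by omega)
    tauto
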